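/- arXiv:2405.12088 — 2 statements merged into one kernel-verified Lean document; each statement's English description precedes it below -/
import Mathlib

section
/- For every ε > 0 there exists n_0(ε) such that for every integer n ≥ n_0(ε), n/(log n)^{2+ε} < n − F_{4,3}(n) ≤ n − f_{4,3}(n) < n/(log n)^{1 − (e·log 3)/(2√3) − ε}. -/
open Finset Filter

/-- The multiset of the values of `a` can be partitioned into groups,
each consisting of `d` copies of a single number. -/
def TrivialSol (d : ℕ) {k : ℕ} (a : Fin k → ℕ) : Prop :=
  ∀ y : ℕ, d ∣ (List.ofFn a : Multiset ℕ).count y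

/-- `Fkd k d n` is the maximum cardinality of a set `A ⊆ {1,…,n}` such that there are no
`a_1 < a_2 < ⋯ < a_k` in `A` and positive integer `x` with `a_1 ⋯ a_k = x ^ d`. -/
noncomputable def Fkd (k d n : ℕ) : ℕ :=
  sSup {m : ℕ | ∃ A : Finset ℕ, A ⊆ Finset.Icc 1 n ∧ A.card = m ∧
    ∀ (a : Fin k → ℕ) (x : ℕ), (∀ i, a i ∈ A) → StrictMono a → 0 < x →
      (∏ i, a i) ≠ x ^ d}

/-- `fkd k d n` is the maximum cardinality of a set `A ⊆ {1,…,n}` such that whenever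
`a_1, …, a_k ∈ A` (not necessarily distinct) and `a_1 ⋯ a_k = x ^ d` for a positive integer
`x`, the multiset of the `a_i` is trivial. -/
noncomputable def fkd (k d n : ℕ) : ℕ :=
  sSup {m : ℕ | ∃ A : Finset ℕ, A ⊆ Finset.Icc 1 n ∧ A.card = m ∧
    ∀ (a : Fin k → ℕ) (x : ℕ), (∀ i, a i ∈ A) → 0 < x →
      (∏ i, a i) = x ^ d → TrivialSol d a}


lemma aux_sum_div_le (z : ℝ) (hz : 0 ≤ z) (a : ℕ) (ha : a ≠ 0) :
    ∑ x ∈ a.divisors, z ^ (ArithmeticFunction.cardFactors x) ≤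
      (1 + z) ^ (ArithmeticFunction.cardFactors a) := by
  induction a using induction_on_primes with
  | zero => exact absurd rfl ha
  | one => simp
  | prime_mul p a hp ih =>
    have ha' : a ≠ 0 := by rintro rfl; simp at ha
    have hsub : (p * a).divisors ⊆ a.divisors ∪ a.divisors.image (fun x => p * x) := by
      intro x hx
      have hx := Nat.dvd_of_mem_divisors hx
      by_cases h : p ∣ x
      · obtain ⟨y, rfl⟩ := h
        have := Nat.dvd_of_mul_dvd_mul_left hp.pos hx
        exact mem_union_right _ (mem_image.2 ⟨y, by simp [this, ha'], rfl⟩)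
      · have hc : Nat.Coprime x p := ((Nat.Prime.coprime_iff_not_dvd hp).2 h).symm
        have := hc.dvd_of_dvd_mul_left hx
        exact mem_union_left _ (by simp [this, ha'])
    have h1 : ∑ x ∈ (p * a).divisors, z ^ (ArithmeticFunction.cardFactors x) ≤
        ∑ x ∈ a.divisors, z ^ (ArithmeticFunction.cardFactors x) +
        ∑ x ∈ a.divisors.image (fun x => p * x), z ^ (ArithmeticFunction.cardFactors x) := by
      refine (sum_le_sum_of_subset_of_nonneg hsub (fun _ _ _ => by positivity)).trans ?_
      rw [← sum_union_inter]
      have : 0 ≤ ∑ x ∈ a.divisors ∩ a.divisors.image (fun x => p * x),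
        z ^ (ArithmeticFunction.cardFactors x) := sum_nonneg (fun _ _ => by positivity)
      linarith
    rw [sum_image (fun x _ y _ h => Nat.eq_of_mul_eq_mul_left hp.pos h)] at h1
    have h2 : ∑ x ∈ a.divisors, z ^ (ArithmeticFunction.cardFactors (p * x)) =
        z * ∑ x ∈ a.divisors, z ^ (ArithmeticFunction.cardFactors x) := by
      rw [mul_sum]
      refine sum_congr rfl fun x hx => ?_
      have : x ≠ 0 := (Nat.pos_of_mem_divisors hx).ne'
      rw [ArithmeticFunction.cardFactors_mul hp.ne_zero this,
        ArithmeticFunction.cardFactors_apply_prime hp]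
      ring
    rw [ArithmeticFunction.cardFactors_mul hp.ne_zero ha',
        ArithmeticFunction.cardFactors_apply_prime hp, pow_add, pow_one]
    have := ih ha'
    nlinarith

lemma aux_sum_div_ge (z w : ℝ) (hz : 0 ≤ z) (hw : 0 ≤ w) (a : ℕ) (ha : Squarefree a) :
    (z + w) ^ (ArithmeticFunction.cardFactors a) ≤
    ∑ x ∈ a.divisorsAntidiagonal, z ^ (ArithmeticFunction.cardFactors x.1) *
      w ^ (ArithmeticFunction.cardFactors x.2) := by
  induction a using induction_on_primes with
  | zero => exact absurd ha (by simp)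
  | one => simp
  | prime_mul p a hp ih =>
    have ha' : a ≠ 0 := by rintro rfl; simp at ha
    have hpa : ¬ p ∣ a := by
      rintro ⟨b, rfl⟩
      have := ha p ⟨b, by ring⟩
      exact hp.one_lt.ne' (Nat.isUnit_iff.1 this)
    have hsq : Squarefree a := ha.squarefree_of_dvd (Dvd.intro_left p rfl)
    set I1 := a.divisorsAntidiagonal.image (fun x : ℕ × ℕ => (p * x.1, x.2))
    set I2 := a.divisorsAntidiagonal.image (fun x : ℕ × ℕ => (x.1, p * x.2))
    have hsub : I1 ∪ I2 ⊆ (p * a).divisorsAntidiagonal := by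
      intro x hx
      simp only [I1, I2, mem_union, mem_image, Nat.mem_divisorsAntidiagonal] at hx
      rw [Nat.mem_divisorsAntidiagonal]
      refine ⟨?_, ha.ne_zero⟩
      rcases hx with ⟨y, ⟨hy, _⟩, rfl⟩ | ⟨y, ⟨hy, _⟩, rfl⟩
      · simp only; rw [← hy]; ring
      · simp only; rw [← hy]; ring
    have hdis : Disjoint I1 I2 := by
      rw [disjoint_left]
      intro x hx hx2
      simp only [I1, I2, mem_image, Nat.mem_divisorsAntidiagonal] at hx hx2
      obtain ⟨y, ⟨hy, _⟩, rfl⟩ := hx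
      obtain ⟨t, ⟨ht, _⟩, h⟩ := hx2
      simp only [Prod.mk.injEq] at h
      apply hpa
      rw [← ht, h.1]
      exact ⟨y.1 * t.2, by ring⟩
    refine le_trans ?_ (sum_le_sum_of_subset_of_nonneg hsub (fun _ _ _ => by positivity))
    rw [sum_union hdis, sum_image, sum_image]
    · have e1 : ∑ x ∈ a.divisorsAntidiagonal, z ^ (ArithmeticFunction.cardFactors (p * x.1)) *
          w ^ (ArithmeticFunction.cardFactors x.2) = z * ∑ x ∈ a.divisorsAntidiagonal,
          z ^ (ArithmeticFunction.cardFactors x.1) * w ^ (ArithmeticFunction.cardFactors x.2) := by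
        rw [mul_sum]
        refine sum_congr rfl fun x hx => ?_
        have hx := Nat.mem_divisorsAntidiagonal.1 hx
        have : x.1 ≠ 0 := by intro h; simp [h] at hx; omega
        rw [ArithmeticFunction.cardFactors_mul hp.ne_zero this,
          ArithmeticFunction.cardFactors_apply_prime hp]
        ring
      have e2 : ∑ x ∈ a.divisorsAntidiagonal, z ^ (ArithmeticFunction.cardFactors x.1) *
          w ^ (ArithmeticFunction.cardFactors (p * x.2)) = w * ∑ x ∈ a.divisorsAntidiagonal,
          z ^ (ArithmeticFunction.cardFactors x.1) * w ^ (ArithmeticFunction.cardFactors x.2) := by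
        rw [mul_sum]
        refine sum_congr rfl fun x hx => ?_
        have hx := Nat.mem_divisorsAntidiagonal.1 hx
        have : x.2 ≠ 0 := by intro h; simp [h] at hx; omega
        rw [ArithmeticFunction.cardFactors_mul hp.ne_zero this,
          ArithmeticFunction.cardFactors_apply_prime hp]
        ring
      rw [e1, e2, ArithmeticFunction.cardFactors_mul hp.ne_zero ha',
        ArithmeticFunction.cardFactors_apply_prime hp, pow_add, pow_one, ← add_mul]
      exact mul_le_mul_of_nonneg_left (ih hsq) (by positivity)
    · intro x _ y _ h
      simp only [Prod.mk.injEq] at h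
      exact Prod.ext h.1 (Nat.eq_of_mul_eq_mul_left hp.pos h.2)
    · intro x _ y _ h
      simp only [Prod.mk.injEq] at h
      exact Prod.ext (Nat.eq_of_mul_eq_mul_left hp.pos h.1) h.2

lemma aux_card_div_le (a : ℕ) (ha : a ≠ 0) :
    (a.divisors.card : ℝ) ≤ 2 ^ (ArithmeticFunction.cardFactors a) := by
  have := aux_sum_div_le 1 (by norm_num) a ha
  norm_num at this
  exact this

/-- number of ordered triples with a given product -/
lemma aux_card_triples (N a : ℕ) (ha : a ≠ 0) :
    ((((Icc 1 N ×ˢ Icc 1 N ×ˢ Icc 1 N).filter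
      (fun t : ℕ × ℕ × ℕ => t.1 * t.2.1 * t.2.2 = a)).card : ℕ) : ℝ)
      ≤ 3 ^ (ArithmeticFunction.cardFactors a) := by
  have h1 : ((Icc 1 N ×ˢ Icc 1 N ×ˢ Icc 1 N).filter
      (fun t : ℕ × ℕ × ℕ => t.1 * t.2.1 * t.2.2 = a)).card ≤
      (a.divisors.sigma (fun x => x.divisors)).card := by
    apply card_le_card_of_injOn (fun t => ⟨t.1 * t.2.1, t.1⟩)
    · intro t ht
      simp only [coe_filter, mem_product, mem_Icc, Set.mem_setOf_eq] at ht
      simp only [coe_sigma, Set.mem_sigma_iff, mem_coe, Nat.mem_divisors]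
      refine ⟨⟨⟨t.2.2, ht.2.symm⟩, ha⟩, ⟨t.2.1, rfl⟩, ?_⟩
      have : 0 < t.1 * t.2.1 := Nat.mul_pos (by omega) (by omega)
      omega
    · intro t ht s hs h
      simp only [coe_filter, mem_product, mem_Icc, Set.mem_setOf_eq] at ht hs
      simp only [Sigma.mk.injEq, heq_eq_eq] at h
      obtain ⟨h1, h2⟩ := h
      have h3 : t.2.1 = s.2.1 := by
        rw [h2] at h1
        exact Nat.eq_of_mul_eq_mul_left (by omega) h1
      have h4 : t.2.2 = s.2.2 := by
        have := ht.2.trans hs.2.symm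
        rw [h1] at this
        exact Nat.eq_of_mul_eq_mul_left (Nat.mul_pos (by omega) (by omega)) this
      exact Prod.ext h2 (Prod.ext h3 h4)
  calc _ ≤ (((a.divisors.sigma (fun x => x.divisors)).card : ℕ) : ℝ) := by exact_mod_cast h1
    _ = ∑ x ∈ a.divisors, (x.divisors.card : ℝ) := by rw [card_sigma]; push_cast; rfl
    _ ≤ ∑ x ∈ a.divisors, 2 ^ (ArithmeticFunction.cardFactors x) :=
        sum_le_sum fun x hx => aux_card_div_le x (Nat.pos_of_mem_divisors hx).ne'
    _ ≤ (1 + 2) ^ (ArithmeticFunction.cardFactors a) := aux_sum_div_le 2 (by norm_num) a ha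
    _ = _ := by norm_num

lemma aux_no_quad (A : Finset ℕ)
    (hA : ∀ (a : Fin 4 → ℕ) (x : ℕ), (∀ i, a i ∈ A) → StrictMono a → 0 < x →
      (∏ i, a i) ≠ x ^ 3) (s : Finset ℕ) (hs : s ⊆ A) (hc : s.card = 4) (x : ℕ) (hx : 0 < x) :
    ∏ y ∈ s, y ≠ x ^ 3 := by
  have := hA (s.orderEmbOfFin hc) x (fun i => hs (s.orderEmbOfFin_mem hc i))
    (s.orderEmbOfFin hc).strictMono hx
  intro h
  apply this
  rw [← h]
  have h2 : s = univ.map (s.orderEmbOfFin hc).toEmbedding := by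
    exact (Finset.map_orderEmbOfFin_univ s hc).symm
  conv_rhs => rw [h2]
  rw [prod_map]
  rfl

lemma aux_quad (A : Finset ℕ)
    (hA : ∀ (a : Fin 4 → ℕ) (x : ℕ), (∀ i, a i ∈ A) → StrictMono a → 0 < x →
      (∏ i, a i) ≠ x ^ 3) (a b c d : ℕ) (ha : 0 < a) (hb : 0 < b) (hc : 0 < c) (hd : 0 < d)
    (hab : a ≠ b) (hac : a ≠ c) (had : a ≠ d) (hbc : b ≠ c) (hbd : b ≠ d) (hcd : c ≠ d)
    (h1 : b * c * d ∈ A) (h2 : a * c * d ∈ A) (h3 : a * b * d ∈ A) (h4 : a * b * c ∈ A) :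
    False := by
  have e1 : b * c * d ≠ a * c * d := by
    intro h; apply hab
    have : b * (c * d) = a * (c * d) := by linarith
    exact (Nat.eq_of_mul_eq_mul_right (Nat.mul_pos hc hd) this).symm
  have e2 : b * c * d ≠ a * b * d := by
    intro h; apply hac
    have : c * (b * d) = a * (b * d) := by linarith
    exact (Nat.eq_of_mul_eq_mul_right (Nat.mul_pos hb hd) this).symm
  have e3 : b * c * d ≠ a * b * c := by
    intro h; apply had
    have : d * (b * c) = a * (b * c) := by linarith
    exact (Nat.eq_of_mul_eq_mul_right (Nat.mul_pos hb hc) this).symm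
  have e4 : a * c * d ≠ a * b * d := by
    intro h; apply hbc
    have : c * (a * d) = b * (a * d) := by linarith
    exact (Nat.eq_of_mul_eq_mul_right (Nat.mul_pos ha hd) this).symm
  have e5 : a * c * d ≠ a * b * c := by
    intro h; apply hbd
    have : d * (a * c) = b * (a * c) := by linarith
    exact (Nat.eq_of_mul_eq_mul_right (Nat.mul_pos ha hc) this).symm
  have e6 : a * b * d ≠ a * b * c := by
    intro h; apply hcd
    exact (Nat.eq_of_mul_eq_mul_left (Nat.mul_pos ha hb) h).symm
  refine aux_no_quad A hA {b * c * d, a * c * d, a * b * d, a * b * c} ?_ ?_ (a * b * c * d)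
    (by positivity) ?_
  · intro x hx
    simp only [mem_insert, mem_singleton] at hx
    rcases hx with rfl | rfl | rfl | rfl <;> assumption
  · rw [card_insert_of_notMem, card_insert_of_notMem, card_insert_of_notMem, card_singleton]
    · simpa using e6
    · simp only [mem_insert, mem_singleton, not_or]; exact ⟨e4, e5⟩
    · simp only [mem_insert, mem_singleton, not_or]; exact ⟨e1, e2, e3⟩
  · rw [prod_insert, prod_insert, prod_insert, prod_singleton]
    · ring
    · simpa using e6
    · simp only [mem_insert, mem_singleton, not_or]; exact ⟨e4, e5⟩
    · simp only [mem_insert, mem_singleton, not_or]; exact ⟨e1, e2, e3⟩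

lemma aux_sw12 (S : Finset ℕ) (F : ℕ → ℕ → ℕ → ℕ → ℝ) :
    ∑ a ∈ S, ∑ b ∈ S, ∑ c ∈ S, ∑ d ∈ S, F a b c d =
    ∑ a ∈ S, ∑ b ∈ S, ∑ c ∈ S, ∑ d ∈ S, F b a c d := sum_comm

lemma aux_sw23 (S : Finset ℕ) (F : ℕ → ℕ → ℕ → ℕ → ℝ) :
    ∑ a ∈ S, ∑ b ∈ S, ∑ c ∈ S, ∑ d ∈ S, F a b c d =
    ∑ a ∈ S, ∑ b ∈ S, ∑ c ∈ S, ∑ d ∈ S, F a c b d := sum_congr rfl fun _ _ => sum_comm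

lemma aux_sw34 (S : Finset ℕ) (F : ℕ → ℕ → ℕ → ℕ → ℝ) :
    ∑ a ∈ S, ∑ b ∈ S, ∑ c ∈ S, ∑ d ∈ S, F a b c d =
    ∑ a ∈ S, ∑ b ∈ S, ∑ c ∈ S, ∑ d ∈ S, F a b d c :=
  sum_congr rfl fun _ _ => sum_congr rfl fun _ _ => sum_comm

lemma aux_c4 (S : Finset ℕ) (F G : ℕ → ℕ → ℕ → ℕ → ℝ) (h : ∀ a b c d, F a b c d = G a b c d) :
    ∑ a ∈ S, ∑ b ∈ S, ∑ c ∈ S, ∑ d ∈ S, F a b c d =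
    ∑ a ∈ S, ∑ b ∈ S, ∑ c ∈ S, ∑ d ∈ S, G a b c d := by
  simp only [h]

lemma aux_weighted (S : Finset ℕ) (u : ℕ → ℝ) (h0 : ∀ a, 0 ≤ u a) (h1 : ∀ a, u a ≤ 1)
    (t : ℕ → ℝ) (ht : ∀ a, 0 ≤ t a)
    (H : ∀ a ∈ S, ∀ b ∈ S, ∀ c ∈ S, ∀ d ∈ S, a ≠ b → a ≠ c → a ≠ d → b ≠ c → b ≠ d → c ≠ d →
      1 ≤ t (b * c * d) + t (a * c * d) + t (a * b * d) + t (a * b * c)) :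
    (∑ a ∈ S, u a) ^ 4 ≤ 6 * (∑ a ∈ S, u a) ^ 3 + 4 * (∑ a ∈ S, u a) *
      ∑ a ∈ S, ∑ b ∈ S, ∑ c ∈ S, u a * u b * u c * t (a * b * c) := by
  set U := ∑ a ∈ S, u a with hU
  set V := ∑ a ∈ S, ∑ b ∈ S, ∑ c ∈ S, u a * u b * u c * t (a * b * c) with hV
  let E : ℕ → ℕ → ℝ := fun a b => if a = b then 1 else 0
  have hE0 : ∀ a b, 0 ≤ E a b := fun a b => by simp only [E]; split_ifs <;> norm_num
  have hEq : ∀ a, E a a = 1 := fun a => by simp [E]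
  have hU0 : 0 ≤ U := sum_nonneg fun a _ => h0 a
  have T0 : ∑ a ∈ S, ∑ b ∈ S, ∑ c ∈ S, ∑ d ∈ S, u a * u b * u c * u d = U ^ 4 := by
    simp only [← mul_sum, ← sum_mul, ← hU]; ring
  have D1 : ∑ a ∈ S, ∑ b ∈ S, ∑ c ∈ S, ∑ d ∈ S, u a * u b * u c * u d * E a b ≤ U ^ 3 := by
    have : ∀ a b c d, u a * u b * u c * u d * E a b = (u a * u b * E a b) * u c * u d := by
      intros; ring
    simp only [this, ← mul_sum, ← sum_mul, ← hU]
    have : ∑ a ∈ S, ∑ b ∈ S, u a * u b * E a b ≤ U := by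
      apply sum_le_sum
      intro a ha
      simp only [E, mul_ite, mul_one, mul_zero, sum_ite_eq, ha, if_true]
      nlinarith [h0 a, h1 a]
    nlinarith [mul_nonneg hU0 hU0]
  have D2 : ∑ a ∈ S, ∑ b ∈ S, ∑ c ∈ S, ∑ d ∈ S, u a * u b * u c * u d * E a c ≤ U ^ 3 := by
    rw [aux_sw23]; exact (aux_c4 _ _ _ (fun a b c d => by ring)).trans_le D1
  have D3 : ∑ a ∈ S, ∑ b ∈ S, ∑ c ∈ S, ∑ d ∈ S, u a * u b * u c * u d * E a d ≤ U ^ 3 := by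
    rw [aux_sw34]; exact (aux_c4 _ _ _ (fun a b c d => by ring)).trans_le D2
  have D4 : ∑ a ∈ S, ∑ b ∈ S, ∑ c ∈ S, ∑ d ∈ S, u a * u b * u c * u d * E b c ≤ U ^ 3 := by
    rw [aux_sw12]; exact (aux_c4 _ _ _ (fun a b c d => by ring)).trans_le D2
  have D5 : ∑ a ∈ S, ∑ b ∈ S, ∑ c ∈ S, ∑ d ∈ S, u a * u b * u c * u d * E b d ≤ U ^ 3 := by
    rw [aux_sw12]; exact (aux_c4 _ _ _ (fun a b c d => by ring)).trans_le D3
  have D6 : ∑ a ∈ S, ∑ b ∈ S, ∑ c ∈ S, ∑ d ∈ S, u a * u b * u c * u d * E c d ≤ U ^ 3 := by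
    rw [aux_sw23]; exact (aux_c4 _ _ _ (fun a b c d => by ring)).trans_le D5
  have V1 : ∑ a ∈ S, ∑ b ∈ S, ∑ c ∈ S, ∑ d ∈ S, u a * u b * u c * u d * t (a * b * c) = U * V := by
    have : ∀ a b c d, u a * u b * u c * u d * t (a * b * c) =
      (u a * u b * u c * t (a * b * c)) * u d := by intros; ring
    simp only [this, ← mul_sum, ← sum_mul, ← hU, ← hV]; ring
  have V2 : ∑ a ∈ S, ∑ b ∈ S, ∑ c ∈ S, ∑ d ∈ S, u a * u b * u c * u d * t (a * b * d) = U * V := by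
    rw [aux_sw34]; exact (aux_c4 _ _ _ (fun a b c d => by ring)).trans V1
  have V3 : ∑ a ∈ S, ∑ b ∈ S, ∑ c ∈ S, ∑ d ∈ S, u a * u b * u c * u d * t (a * c * d) = U * V := by
    rw [aux_sw23]; exact (aux_c4 _ _ _ (fun a b c d => by ring)).trans V2
  have V4 : ∑ a ∈ S, ∑ b ∈ S, ∑ c ∈ S, ∑ d ∈ S, u a * u b * u c * u d * t (b * c * d) = U * V := by
    rw [aux_sw12]; exact (aux_c4 _ _ _ (fun a b c d => by ring)).trans V3
  have main : ∑ a ∈ S, ∑ b ∈ S, ∑ c ∈ S, ∑ d ∈ S, u a * u b * u c * u d ≤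
      ∑ a ∈ S, ∑ b ∈ S, ∑ c ∈ S, ∑ d ∈ S, (u a * u b * u c * u d * E a b +
        u a * u b * u c * u d * E a c + u a * u b * u c * u d * E a d +
        u a * u b * u c * u d * E b c + u a * u b * u c * u d * E b d +
        u a * u b * u c * u d * E c d + u a * u b * u c * u d * t (a * b * c) +
        u a * u b * u c * u d * t (a * b * d) + u a * u b * u c * u d * t (a * c * d) +
        u a * u b * u c * u d * t (b * c * d)) := by
    refine sum_le_sum fun a ha => sum_le_sum fun b hb => sum_le_sum fun c hc =>
      sum_le_sum fun d hd => ?_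
    have hw : 0 ≤ u a * u b * u c * u d :=
      mul_nonneg (mul_nonneg (mul_nonneg (h0 a) (h0 b)) (h0 c)) (h0 d)
    simp only [← mul_add]
    refine le_mul_of_one_le_right hw ?_
    have p1 := hE0 a b
    have p2 := hE0 a c
    have p3 := hE0 a d
    have p4 := hE0 b c
    have p5 := hE0 b d
    have p6 := hE0 c d
    have q1 := ht (a * b * c)
    have q2 := ht (a * b * d)
    have q3 := ht (a * c * d)
    have q4 := ht (b * c * d)
    by_cases e1 : a = b
    · have : E a b = 1 := by rw [e1, hEq]
      linarith
    by_cases e2 : a = c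
    · have : E a c = 1 := by rw [e2, hEq]
      linarith
    by_cases e3 : a = d
    · have : E a d = 1 := by rw [e3, hEq]
      linarith
    by_cases e4 : b = c
    · have : E b c = 1 := by rw [e4, hEq]
      linarith
    by_cases e5 : b = d
    · have : E b d = 1 := by rw [e5, hEq]
      linarith
    by_cases e6 : c = d
    · have : E c d = 1 := by rw [e6, hEq]
      linarith
    have := H a ha b hb c hc d hd e1 e2 e3 e4 e5 e6
    linarith
  simp only [sum_add_distrib] at main
  rw [T0, V1, V2, V3, V4] at main
  linarith

lemma aux_comb (n N : ℕ) (hN : N ^ 3 ≤ n) (A : Finset ℕ) (hAn : A ⊆ Icc 1 n)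
    (hA : ∀ (a : Fin 4 → ℕ) (x : ℕ), (∀ i, a i ∈ A) → StrictMono a → 0 < x →
      (∏ i, a i) ≠ x ^ 3) :
    (∑ b ∈ Icc 1 N, (1 / 3 : ℝ) ^ (ArithmeticFunction.cardFactors b)) ^ 4 ≤
      6 * (∑ b ∈ Icc 1 N, (1 / 3 : ℝ) ^ (ArithmeticFunction.cardFactors b)) ^ 3 +
      4 * (∑ b ∈ Icc 1 N, (1 / 3 : ℝ) ^ (ArithmeticFunction.cardFactors b)) *
        ((n : ℝ) - A.card) := by
  set t : ℕ → ℝ := fun x => if x ∈ A then 0 else 1 with htdef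
  have ht : ∀ a, 0 ≤ t a := fun a => by simp only [t]; split_ifs <;> norm_num
  set S := Icc 1 N with hS
  have hw := aux_weighted S (fun b => (1 / 3 : ℝ) ^ (ArithmeticFunction.cardFactors b))
    (fun a => by positivity) (fun a => pow_le_one₀ (by norm_num) (by norm_num)) t ht (by
      intro a ha b hb c hc d hd hab hac had hbc hbd hcd
      simp only [S, mem_Icc] at ha hb hc hd
      by_cases h1 : b * c * d ∈ A
      · by_cases h2 : a * c * d ∈ A
        · by_cases h3 : a * b * d ∈ A
          · by_cases h4 : a * b * c ∈ A
            · exact (aux_quad A hA a b c d (by omega) (by omega) (by omega) (by omega)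
                hab hac had hbc hbd hcd h1 h2 h3 h4).elim
            · have : t (a * b * c) = 1 := by simp [t, h4]
              linarith [ht (b * c * d), ht (a * c * d), ht (a * b * d)]
          · have : t (a * b * d) = 1 := by simp [t, h3]
            linarith [ht (b * c * d), ht (a * c * d), ht (a * b * c)]
        · have : t (a * c * d) = 1 := by simp [t, h2]
          linarith [ht (b * c * d), ht (a * b * d), ht (a * b * c)]
      · have : t (b * c * d) = 1 := by simp [t, h1]
        linarith [ht (a * c * d), ht (a * b * d), ht (a * b * c)])
  have hU0 : 0 ≤ ∑ b ∈ S, (1 / 3 : ℝ) ^ (ArithmeticFunction.cardFactors b) :=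
    sum_nonneg fun _ _ => by positivity
  have hV : ∑ a ∈ S, ∑ b ∈ S, ∑ c ∈ S, (1 / 3 : ℝ) ^ (ArithmeticFunction.cardFactors a) *
      (1 / 3 : ℝ) ^ (ArithmeticFunction.cardFactors b) *
      (1 / 3 : ℝ) ^ (ArithmeticFunction.cardFactors c) * t (a * b * c) ≤ (n : ℝ) - A.card := by
    have e1 : ∑ a ∈ S, ∑ b ∈ S, ∑ c ∈ S, (1 / 3 : ℝ) ^ (ArithmeticFunction.cardFactors a) *
      (1 / 3 : ℝ) ^ (ArithmeticFunction.cardFactors b) *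
      (1 / 3 : ℝ) ^ (ArithmeticFunction.cardFactors c) * t (a * b * c) =
      ∑ q ∈ S ×ˢ S ×ˢ S, (1 / 3 : ℝ) ^ (ArithmeticFunction.cardFactors (q.1 * q.2.1 * q.2.2)) *
        t (q.1 * q.2.1 * q.2.2) := by
      rw [sum_product]
      refine sum_congr rfl fun a ha => ?_
      rw [sum_product]
      refine sum_congr rfl fun b hb => sum_congr rfl fun c hc => ?_
      simp only [S, mem_Icc] at ha hb hc
      have ha0 : a ≠ 0 := by omega
      have hb0 : b ≠ 0 := by omega
      have hc0 : c ≠ 0 := by omega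
      simp only
      rw [ArithmeticFunction.cardFactors_mul (mul_ne_zero ha0 hb0) hc0,
        ArithmeticFunction.cardFactors_mul ha0 hb0, pow_add, pow_add]
    rw [e1]
    have hmaps : ∀ q ∈ S ×ˢ S ×ˢ S, q.1 * q.2.1 * q.2.2 ∈ Icc 1 n := by
      intro q hq
      simp only [S, mem_product, mem_Icc] at hq
      obtain ⟨⟨a1, a2⟩, ⟨b1, b2⟩, c1, c2⟩ := hq
      rw [mem_Icc]
      constructor
      · have : 0 < q.1 * q.2.1 * q.2.2 := by positivity
        omega
      · calc q.1 * q.2.1 * q.2.2 ≤ N * N * N := by gcongr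
          _ = N ^ 3 := by ring
          _ ≤ n := hN
    rw [← sum_fiberwise_of_maps_to hmaps]
    have e2 : ∀ a ∈ Icc 1 n, ∑ q ∈ (S ×ˢ S ×ˢ S).filter (fun q => q.1 * q.2.1 * q.2.2 = a),
        (1 / 3 : ℝ) ^ (ArithmeticFunction.cardFactors (q.1 * q.2.1 * q.2.2)) *
        t (q.1 * q.2.1 * q.2.2) ≤ t a := by
      intro a ha
      have : ∀ q ∈ (S ×ˢ S ×ˢ S).filter (fun q => q.1 * q.2.1 * q.2.2 = a),
        (1 / 3 : ℝ) ^ (ArithmeticFunction.cardFactors (q.1 * q.2.1 * q.2.2)) *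
        t (q.1 * q.2.1 * q.2.2) = (1 / 3 : ℝ) ^ (ArithmeticFunction.cardFactors a) * t a := by
        intro q hq
        rw [(mem_filter.1 hq).2]
      rw [sum_congr rfl this, sum_const, nsmul_eq_mul]
      have h3 := aux_card_triples N a (by have := (mem_Icc.1 ha).1; omega)
      calc _ ≤ 3 ^ (ArithmeticFunction.cardFactors a) *
            ((1 / 3 : ℝ) ^ (ArithmeticFunction.cardFactors a) * t a) := by
            apply mul_le_mul_of_nonneg_right h3
            exact mul_nonneg (by positivity) (ht a)
        _ = (3 * (1 / 3) : ℝ) ^ (ArithmeticFunction.cardFactors a) * t a := by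
            rw [mul_pow]; ring
        _ = t a := by norm_num
    refine (sum_le_sum e2).trans ?_
    have e3 : ∀ a, t a = 1 - (if a ∈ A then 1 else 0) := by
      intro a; simp only [t]; split_ifs <;> norm_num
    simp only [e3, sum_sub_distrib, sum_const, Nat.card_Icc, nsmul_eq_mul, mul_one,
      add_tsub_cancel_right]
    rw [← sum_filter, sum_const, nsmul_eq_mul, mul_one, filter_mem_eq_inter,
      inter_eq_right.2 hAn]
  refine hw.trans ?_
  have := mul_le_mul_of_nonneg_left hV (by positivity : 0 ≤ 4 * ∑ b ∈ S, (1 / 3 : ℝ) ^ (ArithmeticFunction.cardFactors b))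
  linarith

noncomputable def auxG (z : ℝ) (y : ℕ) : ℝ :=
  ∑ s ∈ (Icc 1 y).filter Squarefree, z ^ (ArithmeticFunction.cardFactors s) / (s : ℝ)

lemma auxG_nonneg (z : ℝ) (hz : 0 ≤ z) (y : ℕ) : 0 ≤ auxG z y :=
  sum_nonneg fun _ _ => by positivity

lemma auxG_mul (z w : ℝ) (hz : 0 ≤ z) (hw : 0 ≤ w) (y : ℕ) :
    auxG (z + w) y ≤ auxG z y * auxG w y := by
  unfold auxG
  set S := (Icc 1 y).filter Squarefree with hS
  rw [sum_mul_sum, ← sum_product']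
  have hsub : S.biUnion (fun a => a.divisorsAntidiagonal) ⊆ S ×ˢ S := by
    intro x hx
    simp only [mem_biUnion, Nat.mem_divisorsAntidiagonal, S, mem_filter, mem_Icc] at hx
    obtain ⟨a, ⟨⟨h1, h2⟩, h3⟩, h4, h5⟩ := hx
    have hd1 : x.1 ∣ a := ⟨x.2, h4.symm⟩
    have hd2 : x.2 ∣ a := ⟨x.1, by rw [← h4]; ring⟩
    simp only [mem_product, S, mem_filter, mem_Icc]
    exact ⟨⟨⟨Nat.pos_of_dvd_of_pos hd1 h1, (Nat.le_of_dvd h1 hd1).trans h2⟩,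
      h3.squarefree_of_dvd hd1⟩, ⟨Nat.pos_of_dvd_of_pos hd2 h1, (Nat.le_of_dvd h1 hd2).trans h2⟩,
      h3.squarefree_of_dvd hd2⟩
  refine le_trans ?_ (sum_le_sum_of_subset_of_nonneg hsub (fun _ _ _ => by positivity))
  rw [sum_biUnion]
  · refine sum_le_sum fun a ha => ?_
    have h := aux_sum_div_ge z w hz hw a (mem_filter.1 ha).2
    have ha1 : 1 ≤ a := (mem_Icc.1 (mem_filter.1 ha).1).1
    have ha0 : (0 : ℝ) < a := by exact_mod_cast ha1
    rw [div_le_iff₀ ha0, sum_mul]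
    refine h.trans (sum_le_sum fun x hx => ?_)
    have hx := Nat.mem_divisorsAntidiagonal.1 hx
    have : (a : ℝ) = x.1 * x.2 := by rw [← hx.1]; push_cast; ring
    have h0 : (x.1 : ℝ) * x.2 ≠ 0 := by rw [← this]; exact ha0.ne'
    have h1 : (x.1 : ℝ) ≠ 0 := left_ne_zero_of_mul h0
    have h2 : (x.2 : ℝ) ≠ 0 := right_ne_zero_of_mul h0
    rw [this]
    apply le_of_eq
    field_simp
  · intro a _ b _ hab
    simp only [Function.onFun]
    rw [disjoint_left]
    intro x hx hx2
    exact hab ((Nat.mem_divisorsAntidiagonal.1 hx).1.symm.trans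
      (Nat.mem_divisorsAntidiagonal.1 hx2).1)

lemma aux_sum_inv_sq (y : ℕ) : ∑ d ∈ Icc 1 y, ((d : ℝ) ^ 2)⁻¹ ≤ 2 := by
  rcases Nat.eq_zero_or_pos y with rfl | hy
  · simp
  rw [← Finset.add_sum_Ioc_eq_sum_Icc (by omega)]
  have := sum_Ioc_inv_sq_le_sub (α := ℝ) (k := 1) (n := y) (by norm_num) hy
  have h2 : (0 : ℝ) ≤ (y : ℝ)⁻¹ := by positivity
  simp only [Nat.cast_one] at this ⊢
  norm_num at this ⊢
  linarith

lemma aux_harm (y : ℕ) : Real.log (y + 1) ≤ ∑ m ∈ Icc 1 y, (m : ℝ)⁻¹ := by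
  have := log_add_one_le_harmonic y
  rw [harmonic_eq_sum_Icc] at this
  push_cast at this
  exact_mod_cast this

lemma auxG_one (y : ℕ) : Real.log (y + 1) / 2 ≤ auxG 1 y := by
  have key : ∑ m ∈ Icc 1 y, (m : ℝ)⁻¹ ≤ auxG 1 y * ∑ d ∈ Icc 1 y, ((d : ℝ) ^ 2)⁻¹ := by
    choose α β h1 h2 using Nat.sq_mul_squarefree
    unfold auxG
    rw [sum_mul_sum, ← sum_product']
    have hinj : Set.InjOn (fun m => (α m, β m)) (Icc 1 y : Finset ℕ) := by
      intro m _ k _ h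
      simp only [Prod.mk.injEq] at h
      rw [← h1 m, ← h1 k, h.1, h.2]
    have e : ∑ m ∈ Icc 1 y, (m : ℝ)⁻¹ = ∑ x ∈ (Icc 1 y).image (fun m => (α m, β m)),
        (1 : ℝ) ^ (ArithmeticFunction.cardFactors x.1) / (x.1 : ℝ) * ((x.2 : ℝ) ^ 2)⁻¹ := by
      rw [sum_image hinj]
      refine sum_congr rfl fun m hm => ?_
      conv_lhs => rw [← h1 m]
      push_cast
      rw [one_pow, mul_inv]
      ring
    rw [e]
    refine sum_le_sum_of_subset_of_nonneg ?_ (fun _ _ _ => by positivity)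
    intro x hx
    obtain ⟨m, hm, rfl⟩ := mem_image.1 hx
    rw [mem_Icc] at hm
    have e := h1 m
    have hβ : β m ≠ 0 := by intro h; rw [h] at e; simp at e; omega
    have hα : α m ≠ 0 := (h2 m).ne_zero
    have b1 : 1 ≤ β m := Nat.one_le_iff_ne_zero.2 hβ
    have b2 : 1 ≤ α m := Nat.one_le_iff_ne_zero.2 hα
    simp only [mem_product, mem_filter, mem_Icc]
    refine ⟨⟨⟨b2, ?_⟩, h2 m⟩, b1, ?_⟩
    · nlinarith [Nat.mul_le_mul b1 b1]
    · nlinarith [Nat.mul_le_mul b1 b2]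
  have h0 := auxG_nonneg 1 (by norm_num) y
  have := aux_sum_inv_sq y
  have := aux_harm y
  nlinarith

lemma aux_primes : ∃ m0 : ℕ, ∀ m : ℕ, m0 ≤ m → ∀ y : ℕ, y ^ 2 ≤ m →
    (m : ℝ) / (4 * Real.log m) ≤ (((Ioc y m).filter Nat.Prime).card : ℝ) := by
  have h1 := (isLittleO_log_rpow_atTop (r := 1 / 2) (by norm_num)).bound
    (show (0 : ℝ) < 1 / 10 by norm_num)
  obtain ⟨x0, hx0⟩ := eventually_atTop.1 h1
  refine ⟨max 3 ⌈x0⌉₊, fun m hm y hy => ?_⟩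
  have hm3 : 3 ≤ m := le_trans (le_max_left _ _) hm
  have hmx : x0 ≤ m := (Nat.le_ceil x0).trans (by exact_mod_cast le_trans (le_max_right _ _) hm)
  have hm3' : (3 : ℝ) ≤ m := by exact_mod_cast hm3
  have hlog := hx0 m hmx
  have hlp : 0 < Real.log m := Real.log_pos (by linarith)
  rw [← Real.sqrt_eq_rpow, Real.norm_of_nonneg hlp.le, Real.norm_of_nonneg (Real.sqrt_nonneg _)]
    at hlog
  have hsq := Real.mul_self_sqrt (show (0 : ℝ) ≤ m by linarith)
  have hs1 : 1 ≤ √(m : ℝ) := Real.one_le_sqrt.2 (by linarith)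
  have hys : (y : ℝ) ≤ √(m : ℝ) := Real.le_sqrt_of_sq_le (by exact_mod_cast hy)
  have hpsi := Chebyshev.psi_ge m
  have hpi := Chebyshev.psi_le_primeCounting_mul_log m
  have hl1 : Real.log (m + 1) ≤ 2 * Real.log m := by
    rw [← Real.log_rpow (by linarith)]
    apply Real.log_le_log (by linarith)
    norm_num
    nlinarith
  have hl2 := Real.log_two_gt_d9
  have hcard : (Nat.primeCounting m : ℝ) ≤ y + (((Ioc y m).filter Nat.Prime).card : ℝ) := by
    have : Nat.primeCounting m ≤ y + ((Ioc y m).filter Nat.Prime).card := by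
      have e : Nat.primeCounting m = ((Ioc 0 m).filter Nat.Prime).card := by
        rw [Nat.primeCounting, Nat.primeCounting', Nat.count_eq_card_filter_range]
        congr 1
        ext p
        simp only [mem_filter, mem_range, mem_Ioc]
        constructor
        · rintro ⟨h, hp⟩; exact ⟨⟨hp.pos, by omega⟩, hp⟩
        · rintro ⟨h, hp⟩; exact ⟨by omega, hp⟩
      rw [e]
      have hsub : (Ioc 0 m).filter Nat.Prime ⊆ Ioc 0 y ∪ (Ioc y m).filter Nat.Prime := by
        intro p hp
        simp only [mem_union, mem_filter, mem_Ioc] at *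
        by_cases h : p ≤ y
        · left; omega
        · right; exact ⟨⟨by omega, by omega⟩, hp.2⟩
      refine (card_le_card hsub).trans ((card_union_le _ _).trans ?_)
      simp
    exact_mod_cast this
  rw [div_le_iff₀ (by positivity)]
  nlinarith [mul_le_mul_of_nonneg_right hcard hlp.le, mul_le_mul_of_nonneg_right hys hlp.le,
    mul_le_mul_of_nonneg_left hlog (Real.sqrt_nonneg (m : ℝ))]

noncomputable def auxU (N : ℕ) : ℝ :=
  ∑ b ∈ Icc 1 N, (1 / 3 : ℝ) ^ (ArithmeticFunction.cardFactors b)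

lemma auxU_ge : ∃ y0 : ℕ, ∀ y N : ℕ, y0 ≤ y → y ^ 3 ≤ N →
    (N : ℝ) / (24 * Real.log N) * auxG (1 / 3) y ≤ auxU N := by
  obtain ⟨m0, hm0⟩ := aux_primes
  refine ⟨max 2 m0, fun y N hy hN => ?_⟩
  have hy2 : 2 ≤ y := le_trans (le_max_left _ _) hy
  have hym : m0 ≤ y := le_trans (le_max_right _ _) hy
  set S := (Icc 1 y).filter Squarefree with hS
  set T := S.sigma (fun s => (Ioc y (N / s)).filter Nat.Prime) with hT
  have hyN : y ≤ N := le_trans (by nlinarith [Nat.mul_le_mul hy2 hy2]) hN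
  have hNR : (2 : ℝ) ≤ N := by exact_mod_cast hy2.trans hyN
  have hlN : 0 < Real.log N := Real.log_pos (by linarith)
  have hinj : Set.InjOn (fun q : (Σ _ : ℕ, ℕ) => q.1 * q.2) (T : Set (Σ _ : ℕ, ℕ)) := by
    rintro ⟨s, p⟩ hq ⟨s', p'⟩ hq' h
    simp only [T, S, mem_coe, mem_sigma, mem_filter, mem_Icc, mem_Ioc] at hq hq' h
    have hpp : p ∣ s' * p' := ⟨s, by rw [← h]; ring⟩
    have : p = p' := by
      rcases hq.2.2.dvd_mul.1 hpp with h1 | h1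
      · have := Nat.le_of_dvd (by omega) h1
        omega
      · exact (Nat.prime_dvd_prime_iff_eq hq.2.2 hq'.2.2).1 h1
    subst this
    have : s = s' := Nat.eq_of_mul_eq_mul_right hq.2.2.pos h
    subst this
    rfl
  have hsub : T.image (fun q : (Σ _ : ℕ, ℕ) => q.1 * q.2) ⊆ Icc 1 N := by
    intro b hb
    obtain ⟨⟨s, p⟩, hq, rfl⟩ := mem_image.1 hb
    simp only [T, S, mem_sigma, mem_filter, mem_Icc, mem_Ioc] at hq ⊢
    refine ⟨Nat.mul_pos (by omega) hq.2.2.pos, ?_⟩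
    rw [mul_comm]
    exact (Nat.le_div_iff_mul_le (by omega)).1 hq.2.1.2
  unfold auxU
  refine le_trans ?_ (sum_le_sum_of_subset_of_nonneg hsub (fun _ _ _ => by positivity))
  rw [sum_image hinj, sum_sigma]
  unfold auxG
  rw [mul_sum]
  refine sum_le_sum fun s hs => ?_
  have hs' := hs
  simp only [S, mem_filter, mem_Icc] at hs'
  have hsR : (1 : ℝ) ≤ s := by exact_mod_cast hs'.1.1
  have e1 : ∑ p ∈ (Ioc y (N / s)).filter Nat.Prime,
      (1 / 3 : ℝ) ^ (ArithmeticFunction.cardFactors (s * p)) =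
      (((Ioc y (N / s)).filter Nat.Prime).card : ℝ) *
        ((1 / 3 : ℝ) ^ (ArithmeticFunction.cardFactors s) * (1 / 3)) := by
    rw [← nsmul_eq_mul, ← sum_const]
    refine sum_congr rfl fun p hp => ?_
    have hp := (mem_filter.1 hp).2
    rw [ArithmeticFunction.cardFactors_mul (by omega) hp.ne_zero,
      ArithmeticFunction.cardFactors_apply_prime hp, pow_succ]
  simp only
  rw [e1]
  have hmy : y ^ 2 ≤ N / s := by
    rw [Nat.le_div_iff_mul_le (by omega)]
    calc y ^ 2 * s ≤ y ^ 2 * y := by gcongr; omega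
      _ = y ^ 3 := by ring
      _ ≤ N := hN
  have hp := hm0 (N / s) (by nlinarith) y hmy
  have hm2 : 2 ≤ N / s := by nlinarith
  have hlm : 0 < Real.log ((N / s : ℕ) : ℝ) := Real.log_pos (by
    have : (2 : ℝ) ≤ ((N / s : ℕ) : ℝ) := by exact_mod_cast hm2
    linarith)
  have hlm2 : Real.log ((N / s : ℕ) : ℝ) ≤ Real.log N := by
    apply Real.log_le_log
    · exact_mod_cast (by omega : 0 < N / s)
    · exact_mod_cast Nat.div_le_self N s
  have hmR : (N : ℝ) / (2 * s) ≤ ((N / s : ℕ) : ℝ) := by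
    rw [div_le_iff₀ (by positivity)]
    have h := Nat.lt_div_mul_add (a := N) (b := s) (by omega)
    have h2 : N ≤ (N / s) * (2 * s) := by nlinarith
    exact_mod_cast h2
  have hp2 : (N : ℝ) / (2 * s) / (4 * Real.log N) ≤ (((Ioc y (N / s)).filter Nat.Prime).card : ℝ) := by
    refine le_trans ?_ hp
    gcongr
  calc (N : ℝ) / (24 * Real.log N) * ((1 / 3) ^ (ArithmeticFunction.cardFactors s) / (s : ℝ))
      = (N : ℝ) / (2 * s) / (4 * Real.log N) *
        ((1 / 3 : ℝ) ^ (ArithmeticFunction.cardFactors s) * (1 / 3)) := by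
        field_simp; norm_num
    _ ≤ _ := by gcongr

lemma aux_cbrt (n : ℕ) : ∃ N : ℕ, N ^ 3 ≤ n ∧ n < (N + 1) ^ 3 := by
  induction n with
  | zero => exact ⟨0, by norm_num⟩
  | succ n ih =>
    obtain ⟨N, h1, h2⟩ := ih
    by_cases h : n + 1 < (N + 1) ^ 3
    · exact ⟨N, by omega, h⟩
    · refine ⟨N + 1, by omega, ?_⟩
      have : (N + 1) ^ 3 < (N + 1 + 1) ^ 3 := Nat.pow_lt_pow_left (by omega) (by norm_num)
      omega

lemma auxU_cube : ∃ N0 : ℕ, ∀ N : ℕ, N0 ≤ N →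
    (N : ℝ) ^ 3 / (24 ^ 3 * 6 * (Real.log N) ^ 2) ≤ auxU N ^ 3 := by
  obtain ⟨y0, hy0⟩ := auxU_ge
  refine ⟨(y0 + 3) ^ 3, fun N hN => ?_⟩
  obtain ⟨y, h1, h2⟩ := aux_cbrt N
  have hy : y0 + 3 ≤ y := by
    have : (y0 + 3) ^ 3 < (y + 1) ^ 3 := lt_of_le_of_lt hN h2
    have := lt_of_pow_lt_pow_left₀ 3 (by omega) this
    omega
  have h := hy0 y N (by omega) h1
  have hN2 : 2 ≤ N := le_trans (by nlinarith [Nat.zero_le y0, sq_nonneg y0, pow_pos (show 0 < y0 + 3 by omega) 2]) hN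
  have hNR : (2 : ℝ) ≤ N := by exact_mod_cast hN2
  have hlN : 0 < Real.log N := Real.log_pos (by linarith)
  have g0 := auxG_nonneg (1 / 3) (by norm_num) y
  have g1 := auxG_mul (1 / 3) (1 / 3) (by norm_num) (by norm_num) y
  have g2 := auxG_mul (1 / 3 + 1 / 3) (1 / 3) (by norm_num) (by norm_num) y
  have g3 := auxG_one y
  have e : (1 / 3 + 1 / 3 + 1 / 3 : ℝ) = 1 := by norm_num
  rw [e] at g2
  have g4 : Real.log N ≤ 3 * Real.log (y + 1) := by
    rw [← Real.log_rpow (by positivity)]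
    apply Real.log_le_log (by linarith)
    have : (N : ℝ) ≤ ((y : ℝ) + 1) ^ 3 := by exact_mod_cast h2.le
    exact_mod_cast this
  have g5 : Real.log N / 6 ≤ auxG (1 / 3) y ^ 3 := by
    calc Real.log N / 6 ≤ auxG 1 y := by linarith
      _ ≤ _ := g2
      _ ≤ auxG (1 / 3) y * auxG (1 / 3) y * auxG (1 / 3) y := by gcongr
      _ = _ := by ring
  calc (N : ℝ) ^ 3 / (24 ^ 3 * 6 * (Real.log N) ^ 2)
      = ((N : ℝ) / (24 * Real.log N)) ^ 3 * (Real.log N / 6) := by field_simp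
    _ ≤ ((N : ℝ) / (24 * Real.log N)) ^ 3 * auxG (1 / 3) y ^ 3 := by gcongr
    _ = ((N : ℝ) / (24 * Real.log N) * auxG (1 / 3) y) ^ 3 := by ring
    _ ≤ _ := by gcongr

lemma aux_lower : ∃ C : ℝ, 0 < C ∧ ∃ n0 : ℕ, ∀ n : ℕ, n0 ≤ n → ∀ A : Finset ℕ, A ⊆ Icc 1 n →
    (∀ (a : Fin 4 → ℕ) (x : ℕ), (∀ i, a i ∈ A) → StrictMono a → 0 < x →
      (∏ i, a i) ≠ x ^ 3) → (n : ℝ) / (C * (Real.log n) ^ 2) ≤ (n : ℝ) - A.card := by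
  obtain ⟨N0, hN0⟩ := auxU_cube
  refine ⟨24 ^ 3 * 6 * 64, by norm_num, (N0 + 143327234) ^ 3, fun n hn A hA1 hA2 => ?_⟩
  obtain ⟨N, h1, h2⟩ := aux_cbrt n
  have hN : N0 + 143327234 ≤ N := by
    have : (N0 + 143327234) ^ 3 < (N + 1) ^ 3 := lt_of_le_of_lt hn h2
    have := lt_of_pow_lt_pow_left₀ 3 (Nat.zero_le _) this
    exact Nat.lt_succ_iff.1 this
  have hU := hN0 N (le_trans (Nat.le_add_right _ _) hN)
  have hc := aux_comb n N h1 A hA1 hA2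
  change auxU N ^ 4 ≤ 6 * auxU N ^ 3 + 4 * auxU N * ((n : ℝ) - A.card) at hc
  have hNR : (12 : ℝ) ^ 3 * (24 ^ 3 * 6) + 2 ≤ N := by
    have : 143327234 ≤ N := le_trans (Nat.le_add_left _ _) hN
    have h' : ((143327234 : ℕ) : ℝ) ≤ N := Nat.cast_le.2 this
    norm_num at h' ⊢
    exact h'
  have hN1 : (1 : ℝ) < N := by linarith
  have hlN : 0 < Real.log N := Real.log_pos hN1
  have hlN2 : Real.log N ≤ N := Real.log_le_self (by linarith)
  have hU12 : 12 ≤ auxU N := by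
    by_contra hlt
    push Not at hlt
    have hU0 : 0 ≤ auxU N := sum_nonneg fun _ _ => by positivity
    have a1 : auxU N ^ 3 < 12 ^ 3 := by gcongr
    have a2 : (12 : ℝ) ^ 3 ≤ (N : ℝ) ^ 3 / (24 ^ 3 * 6 * (Real.log N) ^ 2) := by
      rw [le_div_iff₀ (by positivity)]
      calc (12 : ℝ) ^ 3 * (24 ^ 3 * 6 * (Real.log N) ^ 2)
          ≤ 12 ^ 3 * (24 ^ 3 * 6 * (N : ℝ) ^ 2) := by gcongr
        _ = (12 ^ 3 * (24 ^ 3 * 6)) * (N : ℝ) ^ 2 := by ring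
        _ ≤ N * (N : ℝ) ^ 2 := by gcongr; linarith
        _ = _ := by ring
    linarith
  have hd : auxU N ^ 3 / 8 ≤ (n : ℝ) - A.card := by
    set U := auxU N
    set V := (n : ℝ) - A.card
    have h3 : U * (U ^ 3) ≤ U * (6 * U ^ 2 + 4 * V) := by nlinarith
    have h4 := le_of_mul_le_mul_left h3 (by linarith)
    nlinarith [sq_nonneg U]
  have hn8 : (n : ℝ) ≤ 8 * (N : ℝ) ^ 3 := by
    have h5 : n ≤ (2 * N) ^ 3 := h2.le.trans (Nat.pow_le_pow_left (by omega) 3)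
    have : (n : ℝ) ≤ (2 * (N : ℝ)) ^ 3 := by exact_mod_cast h5
    nlinarith
  have hNn : (N : ℝ) ≤ n := by
    have : N ≤ n := le_trans (Nat.le_self_pow (by norm_num) N) h1
    exact_mod_cast this
  have hll : Real.log N ≤ Real.log n := Real.log_le_log (by linarith) hNn
  refine le_trans ?_ hd
  calc (n : ℝ) / (24 ^ 3 * 6 * 64 * (Real.log n) ^ 2)
      ≤ 8 * (N : ℝ) ^ 3 / (24 ^ 3 * 6 * 64 * (Real.log N) ^ 2) := by gcongr
    _ = (N : ℝ) ^ 3 / (24 ^ 3 * 6 * (Real.log N) ^ 2) / 8 := by field_simp; norm_num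
    _ ≤ _ := by gcongr

noncomputable def auxh (b : ℕ) : ℝ := (1 / 2 : ℝ) ^ (ArithmeticFunction.cardFactors b)

lemma auxh_nonneg (b : ℕ) : 0 ≤ auxh b := by unfold auxh; positivity
lemma auxh_le_one (b : ℕ) : auxh b ≤ 1 := pow_le_one₀ (by norm_num) (by norm_num)
lemma auxh_mul (a b : ℕ) (ha : a ≠ 0) (hb : b ≠ 0) : auxh (a * b) = auxh a * auxh b := by
  unfold auxh; rw [ArithmeticFunction.cardFactors_mul ha hb, pow_add]

noncomputable def auxH (y : ℕ) : ℝ := ∑ m ∈ Icc 1 y, auxh m / (m : ℝ)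
noncomputable def auxS (y : ℕ) : ℝ := ∑ m ∈ Icc 1 y, auxh m

lemma aux_harm_le (y : ℕ) : ∑ m ∈ Icc 1 y, (m : ℝ)⁻¹ ≤ 1 + Real.log y := by
  have := harmonic_le_one_add_log y
  rw [harmonic_eq_sum_Icc] at this
  push_cast at this
  exact_mod_cast this

lemma auxH_sq (y : ℕ) : auxH y ^ 2 ≤ 1 + 2 * Real.log y := by
  have hm : ∀ q ∈ Icc 1 y ×ˢ Icc 1 y, q.1 * q.2 ∈ Icc 1 (y * y) := by
    intro q hq
    simp only [mem_product, mem_Icc] at hq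
    rw [mem_Icc]
    exact ⟨Nat.mul_pos hq.1.1 hq.2.1, Nat.mul_le_mul hq.1.2 hq.2.2⟩
  have h1 : auxH y ^ 2 ≤ ∑ a ∈ Icc 1 (y * y), (a : ℝ)⁻¹ := by
    unfold auxH
    rw [pow_two, sum_mul_sum, ← sum_product', ← sum_fiberwise_of_maps_to hm]
    refine sum_le_sum fun a ha => ?_
    have ha1 := (mem_Icc.1 ha).1
    have ha0 : a ≠ 0 := by omega
    have e : ∀ q ∈ (Icc 1 y ×ˢ Icc 1 y).filter (fun q => q.1 * q.2 = a),
        auxh q.1 / (q.1 : ℝ) * (auxh q.2 / (q.2 : ℝ)) = auxh a * (a : ℝ)⁻¹ := by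
      intro q hq
      simp only [mem_filter, mem_product, mem_Icc] at hq
      rw [← hq.2, auxh_mul _ _ (by omega) (by omega)]
      push_cast
      rw [mul_inv]
      ring
    rw [sum_congr rfl e, sum_const, nsmul_eq_mul]
    have hc : ((((Icc 1 y ×ˢ Icc 1 y).filter (fun q => q.1 * q.2 = a)).card : ℕ) : ℝ) ≤
        2 ^ (ArithmeticFunction.cardFactors a) := by
      refine le_trans ?_ (aux_card_div_le a ha0)
      have : ((Icc 1 y ×ˢ Icc 1 y).filter (fun q => q.1 * q.2 = a)).card ≤ a.divisors.card := by
        apply card_le_card_of_injOn (fun q => q.1)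
        · intro q hq
          have hq := (mem_filter.1 (mem_coe.1 hq)).2
          exact mem_coe.2 (Nat.mem_divisors.2 ⟨⟨q.2, hq.symm⟩, ha0⟩)
        · intro q hq q' hq' h
          have hq := mem_filter.1 (mem_coe.1 hq)
          have hq' := mem_filter.1 (mem_coe.1 hq')
          simp only [mem_product, mem_Icc] at hq hq' h
          refine Prod.ext h ?_
          have := hq.2.trans hq'.2.symm
          rw [h] at this
          exact Nat.eq_of_mul_eq_mul_left (by omega) this
      exact_mod_cast this
    calc _ ≤ 2 ^ (ArithmeticFunction.cardFactors a) * (auxh a * (a : ℝ)⁻¹) := by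
          apply mul_le_mul_of_nonneg_right hc
          exact mul_nonneg (auxh_nonneg a) (by positivity)
      _ = (2 * (1 / 2) : ℝ) ^ (ArithmeticFunction.cardFactors a) * (a : ℝ)⁻¹ := by
          unfold auxh; rw [mul_pow]; ring
      _ = _ := by norm_num
  refine h1.trans ((aux_harm_le _).trans ?_)
  rcases Nat.eq_zero_or_pos y with rfl | hy
  · simp
  · have : (y : ℝ) ≠ 0 := by exact_mod_cast hy.ne'
    push_cast
    rw [Real.log_mul this this]
    linarith

lemma auxS_log (y : ℕ) : auxS y * Real.log y ≤ 7 * y * auxH y := by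
  have h1 : ∑ b ∈ Icc 1 y, auxh b * Real.log b ≤ (Real.log 4 + 4) * y * auxH y := by
    have e1 : ∀ b ∈ Icc 1 y, auxh b * Real.log b ≤ ∑ x ∈ b.divisorsAntidiagonal,
        auxh x.1 * ArithmeticFunction.vonMangoldt x.2 := by
      intro b hb
      rw [← ArithmeticFunction.vonMangoldt_sum, mul_sum,
        ← Nat.sum_divisorsAntidiagonal' (f := fun _ j => auxh b * ArithmeticFunction.vonMangoldt j)]
      refine sum_le_sum fun x hx => ?_
      have hx := Nat.mem_divisorsAntidiagonal.1 hx
      have h10 : x.1 ≠ 0 := by intro h; rw [h] at hx; simp at hx; omega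
      have h20 : x.2 ≠ 0 := by intro h; rw [h] at hx; simp at hx; omega
      apply mul_le_mul_of_nonneg_right _ ArithmeticFunction.vonMangoldt_nonneg
      rw [← hx.1, auxh_mul _ _ h10 h20]
      exact mul_le_of_le_one_right (auxh_nonneg _) (auxh_le_one _)
    refine (sum_le_sum e1).trans ?_
    rw [← sum_biUnion]
    · have hsub : (Icc 1 y).biUnion (fun a => a.divisorsAntidiagonal) ⊆
          (Icc 1 y ×ˢ Icc 1 y).filter (fun q => q.1 * q.2 ≤ y) := by
        intro x hx
        simp only [mem_biUnion, Nat.mem_divisorsAntidiagonal, mem_Icc] at hx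
        obtain ⟨a, ⟨h1, h2⟩, h4, h5⟩ := hx
        have hd1 : x.1 ∣ a := ⟨x.2, h4.symm⟩
        have hd2 : x.2 ∣ a := ⟨x.1, by rw [← h4]; ring⟩
        simp only [mem_filter, mem_product, mem_Icc]
        exact ⟨⟨⟨Nat.pos_of_dvd_of_pos hd1 h1, (Nat.le_of_dvd h1 hd1).trans h2⟩,
          Nat.pos_of_dvd_of_pos hd2 h1, (Nat.le_of_dvd h1 hd2).trans h2⟩, h4.trans_le h2⟩
      refine (sum_le_sum_of_subset_of_nonneg hsub (fun x _ _ =>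
        mul_nonneg (auxh_nonneg _) ArithmeticFunction.vonMangoldt_nonneg)).trans ?_
      rw [sum_filter, sum_product]
      unfold auxH
      rw [mul_sum]
      refine sum_le_sum fun m hm => ?_
      have hm1 := (mem_Icc.1 hm).1
      have hm0 : (0 : ℝ) < m := by exact_mod_cast hm1
      rw [← sum_filter]
      change ∑ d ∈ (Icc 1 y).filter (fun d => m * d ≤ y), auxh m * ArithmeticFunction.vonMangoldt d ≤ _
      rw [← mul_sum]
      have hpsi : ∑ d ∈ (Icc 1 y).filter (fun d => m * d ≤ y), ArithmeticFunction.vonMangoldt d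
          ≤ (Real.log 4 + 4) * ((y : ℝ) / m) := by
        refine le_trans ?_ (Chebyshev.psi_le_const_mul_self (by positivity))
        unfold Chebyshev.psi
        refine sum_le_sum_of_subset_of_nonneg ?_
          (fun _ _ _ => ArithmeticFunction.vonMangoldt_nonneg)
        intro d hd
        simp only [mem_filter, mem_Icc, mem_Ioc] at hd ⊢
        refine ⟨by omega, Nat.le_floor ?_⟩
        rw [le_div_iff₀ hm0]
        have : d * m ≤ y := by rw [mul_comm]; exact hd.2
        exact_mod_cast this
      calc _ ≤ auxh m * ((Real.log 4 + 4) * ((y : ℝ) / m)) :=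
            mul_le_mul_of_nonneg_left hpsi (auxh_nonneg m)
        _ = _ := by ring
    · intro a _ b _ hab
      simp only [Function.onFun]
      rw [disjoint_left]
      intro x hx hx2
      exact hab ((Nat.mem_divisorsAntidiagonal.1 hx).1.symm.trans
        (Nat.mem_divisorsAntidiagonal.1 hx2).1)
  have h2 : auxS y * Real.log y ≤ ∑ b ∈ Icc 1 y, auxh b * Real.log b + y * auxH y := by
    unfold auxS auxH
    rw [sum_mul, mul_sum, ← sum_add_distrib]
    refine sum_le_sum fun b hb => ?_
    rw [mem_Icc] at hb
    have hb0 : (0 : ℝ) < b := by exact_mod_cast hb.1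
    have hy0 : (0 : ℝ) < y := by exact_mod_cast (by omega : 0 < y)
    have hl : Real.log y - Real.log b ≤ y / b := by
      rw [← Real.log_div hy0.ne' hb0.ne']
      exact Real.log_le_self (by positivity)
    have := mul_le_mul_of_nonneg_left hl (auxh_nonneg b)
    have e : (y : ℝ) * (auxh b / b) = auxh b * (y / b) := by ring
    rw [e]; linarith
  have h3 : 0 ≤ auxH y := sum_nonneg fun m _ => div_nonneg (auxh_nonneg m) (by positivity)
  have h4 : Real.log 4 ≤ 2 := by
    have : Real.log 4 = 2 * Real.log 2 := by
      rw [show (4 : ℝ) = 2 ^ 2 by norm_num, Real.log_pow]; norm_num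
    linarith [Real.log_two_lt_d9]
  have h5 : 0 ≤ (y : ℝ) * auxH y := by positivity
  nlinarith

lemma auxS_le (y : ℕ) (hy : 1 ≤ Real.log y) : auxS y ≤ 14 * y / √(Real.log y) := by
  have h1 := auxS_log y
  have h2 := auxH_sq y
  have h3 : 0 ≤ auxH y := sum_nonneg fun m _ => div_nonneg (auxh_nonneg m) (by positivity)
  have hs : 0 < √(Real.log y) := Real.sqrt_pos.2 (by linarith)
  have hss := Real.mul_self_sqrt (show 0 ≤ Real.log y by linarith)
  have h4 : auxH y ≤ 2 * √(Real.log y) := by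
    apply abs_le_of_sq_le_sq' _ (by positivity) |>.2
    nlinarith
  rw [le_div_iff₀ hs]
  have h5 : auxS y * √(Real.log y) * √(Real.log y) ≤ (14 * y) * √(Real.log y) := by
    calc auxS y * √(Real.log y) * √(Real.log y) = auxS y * Real.log y := by rw [mul_assoc, hss]
      _ ≤ 7 * y * auxH y := h1
      _ ≤ 7 * y * (2 * √(Real.log y)) := by gcongr
      _ = _ := by ring
  exact le_of_mul_le_mul_right h5 hs

open Classical in
noncomputable def auxW (n : ℕ) (Q : ℝ) : Finset ℕ :=
  (Icc 1 n).filter (fun b => (n : ℝ) ≤ Q * (b : ℝ) ^ 3 ∧ (b : ℝ) ^ 3 ≤ n * Q)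

lemma mem_auxW {n : ℕ} {Q : ℝ} {b : ℕ} : b ∈ auxW n Q ↔
    (1 ≤ b ∧ b ≤ n) ∧ (n : ℝ) ≤ Q * (b : ℝ) ^ 3 ∧ (b : ℝ) ^ 3 ≤ n * Q := by
  unfold auxW; rw [mem_filter, mem_Icc]

lemma auxW_log {n : ℕ} {Q : ℝ} (hQ : 1 ≤ Q) (hQl : Real.log Q ≤ Real.log n / 4) {b : ℕ}
    (hb : b ∈ auxW n Q) : Real.log n / 4 ≤ Real.log b := by
  rw [mem_auxW] at hb
  have hb0 : (0 : ℝ) < b := by exact_mod_cast hb.1.1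
  have hn0 : (0 : ℝ) < n := by exact_mod_cast (by omega : 0 < n)
  have := Real.log_le_log hn0 hb.2.1
  rw [Real.log_mul (by positivity) (by positivity), Real.log_pow] at this
  push_cast at this
  linarith

lemma aux_sqrt_quarter (x : ℝ) (hx : 0 ≤ x) : √(x / 4) = √x / 2 := by
  rw [Real.sqrt_div hx, show (4 : ℝ) = 2 ^ 2 by norm_num, Real.sqrt_sq (by norm_num)]

lemma auxW_sum (n : ℕ) (Q : ℝ) (hQ : 1 ≤ Q) (hQl : Real.log Q ≤ Real.log n / 4)
    (hn : 4 ≤ Real.log n) :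
    ∑ b ∈ auxW n Q, auxh b / (b : ℝ) ≤ 56 * (2 + Real.log Q) / √(Real.log n) := by
  have hQ0 : 0 ≤ Real.log Q := Real.log_nonneg hQ
  have hs : 0 < √(Real.log n) := Real.sqrt_pos.2 (by linarith)
  have hmap : ∀ b ∈ auxW n Q, Nat.log 2 b ∈ (auxW n Q).image (Nat.log 2) :=
    fun b hb => mem_image_of_mem _ hb
  rw [← sum_fiberwise_of_maps_to hmap]
  have hin : ∀ i ∈ (auxW n Q).image (Nat.log 2),
      ∑ b ∈ (auxW n Q).filter (fun b => Nat.log 2 b = i), auxh b / (b : ℝ) ≤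
        56 / √(Real.log n) := by
    intro i hi
    obtain ⟨b0, hb0, hb0i⟩ := mem_image.1 hi
    have hpos := (mem_auxW.1 hb0).1.1
    have hlog0 := auxW_log hQ hQl hb0
    have hlt : b0 < 2 ^ (i + 1) := by rw [← hb0i]; exact Nat.lt_pow_succ_log_self (by norm_num) b0
    have hl : Real.log n / 4 ≤ Real.log ((2 ^ (i + 1) : ℕ) : ℝ) := by
      refine hlog0.trans (Real.log_le_log (by exact_mod_cast hpos) ?_)
      exact_mod_cast hlt.le
    have hS := auxS_le (2 ^ (i + 1)) (by linarith)
    have h1 : ∑ b ∈ (auxW n Q).filter (fun b => Nat.log 2 b = i), auxh b / (b : ℝ) ≤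
        auxS (2 ^ (i + 1)) / 2 ^ i := by
      unfold auxS
      rw [sum_div]
      have : (auxW n Q).filter (fun b => Nat.log 2 b = i) ⊆ Icc 1 (2 ^ (i + 1)) := by
        intro b hb
        rw [mem_filter, mem_auxW] at hb
        rw [mem_Icc]
        refine ⟨hb.1.1.1, ?_⟩
        rw [← hb.2]; exact (Nat.lt_pow_succ_log_self (by norm_num) b).le
      refine le_trans (sum_le_sum fun b hb => ?_) (sum_le_sum_of_subset_of_nonneg this
        (fun b _ _ => div_nonneg (auxh_nonneg b) (by positivity)))
      rw [mem_filter, mem_auxW] at hb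
      have : 2 ^ i ≤ b := by
        rw [← hb.2]; exact Nat.pow_log_le_self 2 (by omega)
      have : (2 : ℝ) ^ i ≤ b := by exact_mod_cast this
      exact div_le_div_of_nonneg_left (auxh_nonneg b) (by positivity) this
    refine h1.trans ?_
    have h2 : √(Real.log n) / 2 ≤ √(Real.log ((2 ^ (i + 1) : ℕ) : ℝ)) := by
      rw [← aux_sqrt_quarter _ (by linarith)]
      exact Real.sqrt_le_sqrt hl
    have h3 : auxS (2 ^ (i + 1)) ≤ 14 * ((2 ^ (i + 1) : ℕ) : ℝ) / (√(Real.log n) / 2) :=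
      hS.trans (div_le_div_of_nonneg_left (by positivity) (by positivity) h2)
    rw [div_le_iff₀ (by positivity)]
    refine h3.trans (le_of_eq ?_)
    push_cast
    field_simp
    ring
  refine (sum_le_sum hin).trans ?_
  rw [sum_const, nsmul_eq_mul]
  have hcard : (((auxW n Q).image (Nat.log 2)).card : ℝ) ≤ 2 + Real.log Q := by
    rcases ((auxW n Q).image (Nat.log 2)).eq_empty_or_nonempty with he | hne
    · rw [he]; simp; linarith
    · set I := (auxW n Q).image (Nat.log 2) with hI
      have hsub : I ⊆ Icc (I.min' hne) (I.max' hne) := fun i hi =>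
        mem_Icc.2 ⟨I.min'_le i hi, I.le_max' i hi⟩
      have hc := card_le_card hsub
      rw [Nat.card_Icc] at hc
      obtain ⟨b, hb, hbi⟩ := mem_image.1 (I.max'_mem hne)
      obtain ⟨b', hb', hbi'⟩ := mem_image.1 (I.min'_mem hne)
      have hmm : I.min' hne ≤ I.max' hne := I.min'_le _ (I.max'_mem hne)
      rw [← hbi, ← hbi'] at hc hmm
      rw [mem_auxW] at hb hb'
      have p1 : ((2 ^ Nat.log 2 b : ℕ) : ℝ) ≤ b := by
        exact_mod_cast Nat.pow_log_le_self 2 (by omega)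
      have p2 : (b' : ℝ) ≤ ((2 ^ (Nat.log 2 b' + 1) : ℕ) : ℝ) := by
        exact_mod_cast (Nat.lt_pow_succ_log_self (by norm_num) b').le
      have hb0 : (0 : ℝ) < b := by exact_mod_cast hb.1.1
      have hb0' : (0 : ℝ) < b' := by exact_mod_cast hb'.1.1
      have hn0 : (0 : ℝ) < n := by exact_mod_cast (by omega : 0 < n)
      have q1 := Real.log_le_log (by positivity) p1
      have q2 := Real.log_le_log hb0' p2
      have q3 := Real.log_le_log (by positivity) hb.2.2
      have q4 := Real.log_le_log (by positivity) hb'.2.1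
      rw [Real.log_mul (by positivity) (by positivity), Real.log_pow] at q3 q4
      push_cast at q1 q2 q3 q4
      rw [Real.log_pow] at q1 q2
      push_cast at q2
      have hl2 := Real.log_two_gt_d9
      have hc' : (I.card : ℝ) ≤ Nat.log 2 b + 1 - Nat.log 2 b' := by
        have : I.card + Nat.log 2 b' ≤ Nat.log 2 b + 1 := by omega
        have : (I.card : ℝ) + Nat.log 2 b' ≤ Nat.log 2 b + 1 := by exact_mod_cast this
        linarith
      have k1 : ((Nat.log 2 b : ℝ) - Nat.log 2 b' - 1) * Real.log 2 ≤ 2 / 3 * Real.log Q := by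
        nlinarith
      have k2 : (Nat.log 2 b : ℝ) - Nat.log 2 b' - 1 ≤ Real.log Q := by
        by_contra! hcon
        nlinarith
      linarith
  calc _ ≤ (2 + Real.log Q) * (56 / √(Real.log n)) := by gcongr
    _ = _ := by ring

lemma auxW_inner (n : ℕ) (Q : ℝ) (hQ : 1 ≤ Q) (hQl : Real.log Q ≤ Real.log n / 4)
    (hn : 4 ≤ Real.log n) (t : ℕ) (ht : 1 ≤ t) :
    ∑ e ∈ (auxW n Q).filter (fun e => t * e ≤ n), auxh e ≤ 28 * (n / t) / √(Real.log n) := by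
  have hs : 0 < √(Real.log n) := Real.sqrt_pos.2 (by linarith)
  rcases ((auxW n Q).filter (fun e => t * e ≤ n)).eq_empty_or_nonempty with he | ⟨e0, he0⟩
  · rw [he, sum_empty]; positivity
  have key : ∀ e ∈ (auxW n Q).filter (fun e => t * e ≤ n), 1 ≤ e ∧ e ≤ n / t := by
    intro e he
    rw [mem_filter, mem_auxW] at he
    refine ⟨he.1.1.1, ?_⟩
    rw [Nat.le_div_iff_mul_le (by omega), mul_comm]; exact he.2
  have hk0 := key e0 he0
  have hl : Real.log n / 4 ≤ Real.log ((n / t : ℕ) : ℝ) := by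
    refine (auxW_log hQ hQl (mem_filter.1 he0).1).trans (Real.log_le_log ?_ ?_)
    · exact_mod_cast hk0.1
    · exact_mod_cast hk0.2
  have hS := auxS_le (n / t) (by linarith)
  have h1 : ∑ e ∈ (auxW n Q).filter (fun e => t * e ≤ n), auxh e ≤ auxS (n / t) :=
    sum_le_sum_of_subset_of_nonneg (fun e he => mem_Icc.2 (key e he))
      (fun e _ _ => auxh_nonneg e)
  have h2 : √(Real.log n) / 2 ≤ √(Real.log ((n / t : ℕ) : ℝ)) := by
    rw [← aux_sqrt_quarter _ (by linarith)]
    exact Real.sqrt_le_sqrt hl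
  have h3 : ((n / t : ℕ) : ℝ) ≤ n / t := Nat.cast_div_le
  calc _ ≤ _ := h1
    _ ≤ 14 * ((n / t : ℕ) : ℝ) / √(Real.log ((n / t : ℕ) : ℝ)) := hS
    _ ≤ 14 * ((n / t : ℕ) : ℝ) / (√(Real.log n) / 2) :=
        div_le_div_of_nonneg_left (by positivity) (by positivity) h2
    _ ≤ 14 * (n / t) / (√(Real.log n) / 2) := by gcongr
    _ = _ := by ring

lemma aux_div_bce (a r b c e : ℕ) (ha : a ≠ 0) (h : a = r * b * c * e)
    (hsq : Squarefree (b * c * e)) :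
    1 ≤ (a.divisors.card : ℝ) * (auxh b * auxh c * auxh e) := by
  have hne : b * c * e ≠ 0 := hsq.ne_zero
  have hb : b ≠ 0 := by rintro rfl; simp at hne
  have hc : c ≠ 0 := by rintro rfl; simp at hne
  have he : e ≠ 0 := by rintro rfl; simp at hne
  rw [← auxh_mul b c hb hc, ← auxh_mul (b * c) e (by positivity) he]
  have h1 : (b * c * e).divisors.card ≤ a.divisors.card := by
    apply card_le_card
    apply Nat.divisors_subset_of_dvd ha
    exact ⟨r, by rw [h]; ring⟩
  have h2 : 2 ^ ArithmeticFunction.cardFactors (b * c * e) ≤ (b * c * e).divisors.card := by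
    rw [← (ArithmeticFunction.cardDistinctFactors_eq_cardFactors_iff_squarefree hne).2 hsq,
      Nat.card_divisors hne, ArithmeticFunction.cardDistinctFactors_apply, ← List.card_toFinset]
    refine pow_card_le_prod _ _ _ fun p hp => ?_
    have hp := Nat.mem_primeFactors.1 hp
    have := hp.1.factorization_pos_of_dvd hne hp.2.1
    omega
  have h3 : ((2 : ℝ) ^ ArithmeticFunction.cardFactors (b * c * e)) ≤ a.divisors.card := by
    exact_mod_cast h2.trans h1
  have h4 : (2 : ℝ) ^ ArithmeticFunction.cardFactors (b * c * e) * auxh (b * c * e) = 1 := by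
    unfold auxh; rw [← mul_pow]; norm_num
  rw [← h4]
  exact mul_le_mul_of_nonneg_right h3 (auxh_nonneg _)

def auxBad (n R : ℕ) (Q : ℝ) (a : ℕ) : Prop :=
  ∃ r b c e : ℕ, a = r * b * c * e ∧ r ∈ Icc 1 R ∧ b ∈ auxW n Q ∧ c ∈ auxW n Q ∧
    e ∈ auxW n Q ∧ Squarefree (b * c * e)

lemma auxBad_card (n R : ℕ) (Q M : ℝ) (hQ : 1 ≤ Q) (hQl : Real.log Q ≤ Real.log n / 4)
    (hn : 4 ≤ Real.log n) (hM : 0 ≤ M) (B : Finset ℕ)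
    (hB : ∀ a ∈ B, (1 ≤ a ∧ a ≤ n) ∧ (a.divisors.card : ℝ) ≤ M ∧ auxBad n R Q a) :
    (B.card : ℝ) ≤ M * (28 * n / √(Real.log n) * (1 + Real.log R) *
      (56 * (2 + Real.log Q) / √(Real.log n)) ^ 2) := by
  classical
  set W := auxW n Q with hW
  have hs : 0 < √(Real.log n) := Real.sqrt_pos.2 (by linarith)
  set K := ∑ b ∈ W, auxh b / (b : ℝ) with hK
  have hK0 : 0 ≤ K := sum_nonneg fun b _ => div_nonneg (auxh_nonneg b) (by positivity)
  have hKle : K ≤ 56 * (2 + Real.log Q) / √(Real.log n) := auxW_sum n Q hQ hQl hn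
  let f : ℕ × ℕ × ℕ × ℕ → ℕ := fun q => q.1 * q.2.1 * q.2.2.1 * q.2.2.2
  let g : ℕ × ℕ × ℕ × ℕ → ℝ := fun q => auxh q.2.1 * auxh q.2.2.1 * auxh q.2.2.2
  have hg : ∀ q, 0 ≤ g q := fun q =>
    mul_nonneg (mul_nonneg (auxh_nonneg _) (auxh_nonneg _)) (auxh_nonneg _)
  let P := (Icc 1 R ×ˢ W ×ˢ W ×ˢ W).filter (fun q => f q ≤ n)
  have h1 : (B.card : ℝ) ≤ ∑ a ∈ B, ∑ q ∈ P.filter (fun q => f q = a), M * g q := by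
    rw [card_eq_sum_ones]
    push_cast
    refine sum_le_sum fun a ha => ?_
    obtain ⟨⟨ha1, han⟩, haM, r, b, c, e, hab, hr, hb, hc, he, hsq⟩ := hB a ha
    have hmem : (r, b, c, e) ∈ P.filter (fun q => f q = a) := by
      simp only [P, f, mem_filter, mem_product]
      exact ⟨⟨⟨hr, hb, hc, he⟩, by rw [← hab]; exact han⟩, hab.symm⟩
    refine le_trans ?_ (single_le_sum (f := fun q => M * g q)
      (fun q _ => mul_nonneg hM (hg q)) hmem)
    refine (aux_div_bce a r b c e (by omega) hab hsq).trans ?_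
    exact mul_le_mul_of_nonneg_right haM (hg (r, b, c, e))
  have h2 : ∑ a ∈ B, ∑ q ∈ P.filter (fun q => f q = a), M * g q ≤ ∑ q ∈ P, M * g q := by
    rw [← sum_biUnion]
    · refine sum_le_sum_of_subset_of_nonneg ?_ (fun q _ _ => mul_nonneg hM (hg q))
      intro q hq
      obtain ⟨a, _, hq⟩ := mem_biUnion.1 hq
      exact (mem_filter.1 hq).1
    · intro a _ b _ hab
      simp only [Function.onFun]
      rw [disjoint_left]
      intro x hx hx2
      exact hab ((mem_filter.1 hx).2.symm.trans (mem_filter.1 hx2).2)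
  have h3 : ∑ q ∈ P, g q ≤ ∑ r ∈ Icc 1 R, ∑ b ∈ W, ∑ c ∈ W,
      auxh b * auxh c * (28 * (n / ((r * b * c : ℕ) : ℝ)) / √(Real.log n)) := by
    simp only [P]
    rw [sum_filter, sum_product]
    refine sum_le_sum fun r hr => ?_
    rw [sum_product]
    refine sum_le_sum fun b hb => ?_
    rw [sum_product]
    refine sum_le_sum fun c hc => ?_
    have hb1 := (mem_auxW.1 hb).1.1
    have hc1 := (mem_auxW.1 hc).1.1
    have hr1 := (mem_Icc.1 hr).1
    have := auxW_inner n Q hQ hQl hn (r * b * c) (Nat.mul_pos (Nat.mul_pos hr1 hb1) hc1)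
    have := mul_le_mul_of_nonneg_left this (mul_nonneg (auxh_nonneg b) (auxh_nonneg c))
    rw [mul_sum, sum_filter] at this
    exact this
  have h4 : ∑ r ∈ Icc 1 R, ∑ b ∈ W, ∑ c ∈ W,
      auxh b * auxh c * (28 * (n / ((r * b * c : ℕ) : ℝ)) / √(Real.log n)) =
      28 * n / √(Real.log n) * (∑ r ∈ Icc 1 R, (r : ℝ)⁻¹) * K ^ 2 := by
    rw [hK, pow_two, sum_mul_sum, mul_sum (Icc 1 R), sum_mul]
    refine sum_congr rfl fun r _ => ?_
    rw [mul_sum]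
    refine sum_congr rfl fun b _ => ?_
    rw [mul_sum]
    refine sum_congr rfl fun c _ => ?_
    push_cast
    simp only [div_eq_mul_inv, mul_inv]
    ring
  have h5 := aux_harm_le R
  have h50 : 0 ≤ ∑ r ∈ Icc 1 R, (r : ℝ)⁻¹ := sum_nonneg fun r _ => by positivity
  have hR0 : 0 ≤ 1 + Real.log R := h50.trans h5
  calc (B.card : ℝ) ≤ ∑ q ∈ P, M * g q := h1.trans h2
    _ = M * ∑ q ∈ P, g q := by rw [mul_sum]
    _ ≤ M * (28 * n / √(Real.log n) * (∑ r ∈ Icc 1 R, (r : ℝ)⁻¹) * K ^ 2) := by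
        apply mul_le_mul_of_nonneg_left _ hM
        rw [← h4]; exact h3
    _ ≤ _ := by gcongr

lemma aux_four_bool : ∀ (P : Fin 4 → Bool) (i j k : Fin 4), i ≠ j → P i = false → P j = false →
    P k = true → ¬ 3 ∣ ∑ l, (if P l = true then 1 else 0) := by decide

lemma aux_four (P : Fin 4 → Prop) [DecidablePred P] (i j k : Fin 4) (hij : i ≠ j) (hi : ¬ P i)
    (hj : ¬ P j) (hk : P k) (h : 3 ∣ ∑ l, (if P l then 1 else 0)) : False := by
  refine aux_four_bool (fun l => decide (P l)) i j k hij (by simpa using hi) (by simpa using hj)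
    (by simpa using hk) ?_
  simpa using h

lemma aux_struct (n z x : ℕ) (hz : 1 ≤ z) (a : Fin 4 → ℕ) (ha : ∀ i, 1 ≤ a i ∧ a i ≤ n)
    (hz1 : ∀ i, n ≤ a i * z) (hm : ∀ i m, m ^ 2 ∣ a i → m ≤ z)
    (hx : ∏ i, a i = x ^ 3) : auxBad n (z ^ 6) ((z : ℝ) ^ 28) (a 0) := by
  have hdec : ∀ i, ∃ s m : ℕ, m ^ 2 * s = a i ∧ Squarefree s := by
    intro i
    obtain ⟨s, m, h1, h2⟩ := Nat.sq_mul_squarefree (a i)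
    exact ⟨s, m, h1, h2⟩
  choose s m hms hsq using hdec
  have ha0 : ∀ i, a i ≠ 0 := fun i => by have := (ha i).1; omega
  have hs0 : ∀ i, s i ≠ 0 := fun i => (hsq i).ne_zero
  have hm0 : ∀ i, m i ≠ 0 := by
    intro i h
    have := hms i
    rw [h] at this
    exact ha0 i (by rw [← this]; simp)
  have hmz : ∀ i, m i ≤ z := fun i => hm i (m i) ⟨s i, (hms i).symm⟩
  set D := ∏ i, m i with hD
  have hD0 : D ≠ 0 := prod_ne_zero_iff.2 fun i _ => hm0 i
  have hDz : D ≤ z ^ 4 := by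
    have := prod_le_pow_card univ m z (fun i _ => hmz i)
    simpa using this
  have hmD : ∀ i, m i ∣ D := fun i => dvd_prod_of_mem m (mem_univ i)
  set T : Fin 4 → Finset ℕ := fun i => (a i).primeFactors.filter (fun p => ¬ p ∣ D) with hT
  have hTmem : ∀ i p, p ∈ T i ↔ p.Prime ∧ p ∣ a i ∧ ¬ p ∣ D := by
    intro i p
    simp only [hT, mem_filter, Nat.mem_primeFactors]
    have := ha0 i
    tauto
  have hTs : ∀ i p, p ∈ T i → p ∣ s i := by
    intro i p hp
    rw [hTmem] at hp
    have h := hp.2.1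
    rw [← hms i] at h
    rcases hp.1.dvd_mul.1 h with h | h
    · exact absurd ((hp.1.dvd_of_dvd_pow h).trans (hmD i)) hp.2.2
    · exact h
  have hfac : ∀ p, p.Prime → ¬ p ∣ D → ∀ i, (a i).factorization p = if p ∈ T i then 1 else 0 := by
    intro p hp hpD i
    split_ifs with h
    · have h1 := hTs i p h
      have h2 := (hsq i).natFactorization_le_one p
      have h3 := hp.factorization_pos_of_dvd (hs0 i) h1
      rw [← hms i, Nat.factorization_mul (pow_ne_zero _ (hm0 i)) (hs0 i), Nat.factorization_pow]
      have h4 : (m i).factorization p = 0 :=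
        Nat.factorization_eq_zero_of_not_dvd fun h => hpD (h.trans (hmD i))
      simp [h4]
      omega
    · apply Nat.factorization_eq_zero_of_not_dvd
      intro h'
      exact h ((hTmem i p).2 ⟨hp, h', hpD⟩)
  have hsum : ∀ p, p.Prime → ¬ p ∣ D → 3 ∣ ∑ i, (if p ∈ T i then 1 else 0) := by
    intro p hp hpD
    have h1 : (∏ i, a i).factorization p = ∑ i, (a i).factorization p := by
      rw [Nat.factorization_prod (fun i _ => ha0 i)]
      simp
    rw [hx, Nat.factorization_pow] at h1
    rw [← sum_congr rfl fun i _ => hfac p hp hpD i, ← h1]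
    exact ⟨x.factorization p, by simp⟩
  set U := univ.biUnion T with hU
  have hUmem : ∀ p, p ∈ U ↔ ∃ i, p ∈ T i := by intro p; simp [hU]
  set B : Fin 4 → Finset ℕ := fun i => U \ T i with hB
  set t : Fin 4 → ℕ := fun i => ∏ p ∈ T i, p with ht
  set b : Fin 4 → ℕ := fun i => ∏ p ∈ B i, p with hb
  have htb : ∀ i, b i * t i = ∏ p ∈ U, p := by
    intro i
    exact prod_sdiff (subset_biUnion_of_mem T (mem_univ i))
  have hex : ∀ p ∈ U, p.Prime ∧ ¬ p ∣ D := by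
    intro p hp
    obtain ⟨i, hi⟩ := (hUmem p).1 hp
    exact ⟨((hTmem i p).1 hi).1, ((hTmem i p).1 hi).2.2⟩
  have hUB : U = univ.biUnion B := by
    ext p
    simp only [mem_biUnion, hB, Finset.mem_sdiff, mem_univ, true_and]
    constructor
    · intro hp
      have h3 := hsum p (hex p hp).1 (hex p hp).2
      by_contra! hcon
      have : ∀ i, p ∈ T i := fun i => hcon i hp
      simp [this] at h3
    · rintro ⟨i, h, _⟩; exact h
  have hdisj : ∀ i ∈ (univ : Finset (Fin 4)), ∀ j ∈ (univ : Finset (Fin 4)), i ≠ j →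
      Disjoint (B i) (B j) := by
    intro i _ j _ hij
    rw [disjoint_left]
    intro p hpi hpj
    simp only [hB, Finset.mem_sdiff] at hpi hpj
    have h3 := hsum p (hex p hpi.1).1 (hex p hpi.1).2
    obtain ⟨k, hk⟩ := (hUmem p).1 hpi.1
    exact aux_four _ i j k hij hpi.2 hpj.2 hk h3
  have hprod : ∏ p ∈ U, p = ∏ i, b i := by
    rw [hUB, prod_biUnion hdisj]
  have hts : ∀ i, t i ∣ s i := by
    intro i
    exact Finset.prod_primes_dvd _ (fun p hp => ((hTmem i p).1 hp).1.prime) (fun p hp => hTs i p hp)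
  have hta : ∀ i, t i ∣ a i := fun i => (hts i).trans ⟨m i ^ 2, by rw [← hms i]; ring⟩
  have ht0 : ∀ i, 0 < t i := fun i => Nat.pos_of_dvd_of_pos (hta i) (ha i).1
  have hb0 : ∀ i, 0 < b i := fun i => prod_pos fun p hp =>
    (hex p (Finset.mem_sdiff.1 hp).1).1.pos
  have hsle : ∀ i, s i ≤ t i * D := by
    intro i
    have h1 : s i = ∏ p ∈ (s i).primeFactors, p :=
      (Nat.prod_primeFactors_of_squarefree (hsq i)).symm
    rw [← prod_filter_mul_prod_filter_not (s i).primeFactors (fun p => ¬ p ∣ D)] at h1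
    rw [h1]
    apply Nat.mul_le_mul
    · apply Nat.le_of_dvd (ht0 i)
      apply prod_dvd_prod_of_subset
      intro p hp
      rw [mem_filter, Nat.mem_primeFactors] at hp
      exact (hTmem i p).2 ⟨hp.1.1, hp.1.2.1.trans ⟨m i ^ 2, by rw [← hms i]; ring⟩, hp.2⟩
    · apply Nat.le_of_dvd (Nat.pos_of_ne_zero hD0)
      apply Finset.prod_primes_dvd
      · intro p hp
        exact (Nat.mem_primeFactors.1 (mem_filter.1 hp).1).1.prime
      · intro p hp
        exact not_not.1 (mem_filter.1 hp).2
  have hale : ∀ i, a i ≤ z ^ 6 * t i := by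
    intro i
    calc a i = m i ^ 2 * s i := (hms i).symm
      _ ≤ z ^ 2 * (t i * z ^ 4) := by
          apply Nat.mul_le_mul (Nat.pow_le_pow_left (hmz i) 2)
          exact (hsle i).trans (Nat.mul_le_mul_left _ hDz)
      _ = _ := by ring
  have htn : ∀ i, t i ≤ n := fun i => (Nat.le_of_dvd (ha i).1 (hta i)).trans (ha i).2
  have hnt : ∀ i, n ≤ z ^ 7 * t i := by
    intro i
    calc n ≤ a i * z := hz1 i
      _ ≤ (z ^ 6 * t i) * z := Nat.mul_le_mul_right _ (hale i)
      _ = _ := by ring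
  have hn1 : 0 < n := (ha 0).1.trans (ha 0).2
  have hbb : ∀ i j, b i ≤ z ^ 7 * b j := by
    intro i j
    have e : b i * t i = b j * t j := (htb i).trans (htb j).symm
    refine Nat.le_of_mul_le_mul_left ?_ hn1
    calc n * b i ≤ (z ^ 7 * t i) * b i := Nat.mul_le_mul_right _ (hnt i)
      _ = z ^ 7 * (b i * t i) := by ring
      _ = z ^ 7 * (b j * t j) := by rw [e]
      _ ≤ z ^ 7 * (b j * n) := by gcongr; exact htn j
      _ = _ := by ring
  have ht3 : t 0 = b 1 * b 2 * b 3 := by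
    have h := (htb 0).trans hprod
    rw [Fin.prod_univ_four] at h
    refine Nat.eq_of_mul_eq_mul_left (hb0 0) (h.trans ?_)
    ring
  have hW : ∀ j, b j ∣ t 0 → b j ∈ auxW n ((z : ℝ) ^ 28) := by
    intro j hj
    rw [mem_auxW]
    refine ⟨⟨hb0 j, (Nat.le_of_dvd (ht0 0) hj).trans (htn 0)⟩, ?_, ?_⟩
    · have : n ≤ z ^ 28 * b j ^ 3 := by
        calc n ≤ z ^ 7 * t 0 := hnt 0
          _ ≤ z ^ 7 * ((z ^ 7 * b j) * (z ^ 7 * b j) * (z ^ 7 * b j)) := by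
            rw [ht3]
            exact Nat.mul_le_mul_left _ (Nat.mul_le_mul (Nat.mul_le_mul (hbb _ _) (hbb _ _))
              (hbb _ _))
          _ = z ^ 28 * b j ^ 3 := by ring
      exact_mod_cast this
    · have : b j ^ 3 ≤ n * z ^ 28 := by
        calc b j ^ 3 = b j * b j * b j := by ring
          _ ≤ (z ^ 7 * b 1) * (z ^ 7 * b 2) * (z ^ 7 * b 3) :=
            Nat.mul_le_mul (Nat.mul_le_mul (hbb _ _) (hbb _ _)) (hbb _ _)
          _ = t 0 * z ^ 21 := by rw [ht3]; ring
          _ ≤ n * z ^ 28 := Nat.mul_le_mul (htn 0) (Nat.pow_le_pow_right hz (by norm_num))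
      exact_mod_cast this
  obtain ⟨u, hu⟩ := hta 0
  refine ⟨u, b 1, b 2, b 3, ?_, ?_, hW 1 ?_, hW 2 ?_, hW 3 ?_, ?_⟩
  · rw [hu, ht3]; ring
  · rw [mem_Icc]
    constructor
    · rw [Nat.one_le_iff_ne_zero]
      rintro rfl
      exact ha0 0 (by rw [hu]; simp)
    · refine Nat.le_of_mul_le_mul_left ?_ (ht0 0)
      rw [← hu, mul_comm]
      exact hale 0
  · rw [ht3]; exact ⟨b 2 * b 3, by ring⟩
  · rw [ht3]; exact ⟨b 1 * b 3, by ring⟩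
  · rw [ht3]; exact ⟨b 1 * b 2, by ring⟩
  · rw [← ht3]
    exact (hsq 0).squarefree_of_dvd (hts 0)

lemma aux_mult_card (n d : ℕ) : ((((Icc 1 n).filter (fun a => d ∣ a)).card : ℕ) : ℝ) ≤ n / d := by
  have : (Icc 1 n).filter (fun a => d ∣ a) = (Ioc 0 n).filter (fun a => d ∣ a) := by
    congr 1
  rw [this, Nat.Ioc_filter_dvd_card_eq_div]
  exact Nat.cast_div_le

lemma aux_sum_card_div (n : ℕ) : ∑ a ∈ Icc 1 n, (a.divisors.card : ℝ) ≤ n * (1 + Real.log n) := by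
  have h1 : ∀ a ∈ Icc 1 n, (a.divisors.card : ℝ) ≤ ∑ d ∈ Icc 1 n, if d ∣ a then 1 else 0 := by
    intro a ha
    rw [← sum_filter, sum_const, nsmul_eq_mul, mul_one]
    have : a.divisors.card ≤ ((Icc 1 n).filter (fun d => d ∣ a)).card := by
      apply card_le_card
      intro d hd
      rw [mem_Icc] at ha
      rw [mem_filter, mem_Icc]
      have hd' := Nat.mem_divisors.1 hd
      exact ⟨⟨Nat.pos_of_dvd_of_pos hd'.1 ha.1, (Nat.le_of_dvd ha.1 hd'.1).trans ha.2⟩, hd'.1⟩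
    exact_mod_cast this
  refine (sum_le_sum h1).trans ?_
  rw [sum_comm]
  calc _ ≤ ∑ d ∈ Icc 1 n, (n : ℝ) * (d : ℝ)⁻¹ := by
        refine sum_le_sum fun d _ => ?_
        rw [← sum_filter, sum_const, nsmul_eq_mul, mul_one]
        exact (aux_mult_card n d).trans (le_of_eq (div_eq_mul_inv _ _))
    _ = n * ∑ d ∈ Icc 1 n, (d : ℝ)⁻¹ := by rw [mul_sum]
    _ ≤ _ := mul_le_mul_of_nonneg_left (aux_harm_le n) (by positivity)

lemma aux_upper_raw (n z : ℕ) (M : ℝ) (hz : 1 ≤ z) (hM : 0 < M)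
    (hQl : Real.log ((z : ℝ) ^ 28) ≤ Real.log n / 4) (hn : 4 ≤ Real.log n) :
    ∃ A : Finset ℕ, A ⊆ Icc 1 n ∧ (∀ (a : Fin 4 → ℕ) (x : ℕ), (∀ i, a i ∈ A) → 
      (∏ i, a i) ≠ x ^ 3) ∧
      (n : ℝ) - A.card ≤ 2 * n / z + n * (1 + Real.log n) / M +
        M * (28 * n / √(Real.log n) * (1 + Real.log ((z ^ 6 : ℕ) : ℝ)) *
      (56 * (2 + Real.log ((z : ℝ) ^ 28)) / √(Real.log n)) ^ 2) := by
  classical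
  have hz0 : (0 : ℝ) < z := by exact_mod_cast hz
  set I := Icc 1 n with hI
  let E1 := I.filter (fun a => a * z < n)
  let E2 := I.filter (fun a => ∃ m, z < m ∧ m ^ 2 ∣ a)
  let E3 := I.filter (fun a => M < (a.divisors.card : ℝ))
  let E4 := I.filter (fun a => (a.divisors.card : ℝ) ≤ M ∧ auxBad n (z ^ 6) ((z : ℝ) ^ 28) a)
  let A := I \ (E1 ∪ E2 ∪ E3 ∪ E4)
  refine ⟨A, sdiff_subset, ?_, ?_⟩
  · intro a x ha hx
    have hmem : ∀ i, a i ∈ I ∧ n ≤ a i * z ∧ (∀ m, m ^ 2 ∣ a i → m ≤ z) ∧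
        ¬ auxBad n (z ^ 6) ((z : ℝ) ^ 28) (a i) := by
      intro i
      have h := ha i
      simp only [A, E1, E2, E3, E4, Finset.mem_sdiff, mem_union, mem_filter, not_or, not_and] at h
      obtain ⟨h0, ⟨⟨h1, h2⟩, h3⟩, h4⟩ := h
      refine ⟨h0, not_lt.1 (h1 h0), ?_, h4 h0 (not_lt.1 (h3 h0))⟩
      intro m hm
      by_contra! hc
      exact h2 h0 ⟨m, hc, hm⟩
    exact (hmem 0).2.2.2 (aux_struct n z x hz a (fun i => mem_Icc.1 (hmem i).1)
      (fun i => (hmem i).2.1) (fun i => (hmem i).2.2.1) hx)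
  · have h1 : (E1.card : ℝ) ≤ n / z := by
      have : E1 ⊆ Icc 1 (n / z) := by
        intro a ha
        have ha := mem_filter.1 ha
        rw [mem_Icc]
        exact ⟨(mem_Icc.1 ha.1).1, (Nat.le_div_iff_mul_le hz).2 ha.2.le⟩
      have := card_le_card this
      rw [Nat.card_Icc, Nat.add_sub_cancel] at this
      have : (E1.card : ℝ) ≤ ((n / z : ℕ) : ℝ) := by exact_mod_cast this
      exact this.trans Nat.cast_div_le
    have h2 : (E2.card : ℝ) ≤ n / z := by
      have hsub : E2 ⊆ (Ioc z (max z n)).biUnion (fun m => I.filter (fun a => m ^ 2 ∣ a)) := by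
        intro a ha
        obtain ⟨ha, m, hm, hma⟩ := mem_filter.1 ha
        rw [mem_biUnion]
        refine ⟨m, ?_, mem_filter.2 ⟨ha, hma⟩⟩
        rw [mem_Ioc]
        refine ⟨hm, le_max_of_le_right ?_⟩
        have ha' := mem_Icc.1 ha
        exact ((Nat.le_self_pow two_ne_zero m).trans (Nat.le_of_dvd ha'.1 hma)).trans ha'.2
      have hc := (card_le_card hsub).trans card_biUnion_le
      have hc' : (E2.card : ℝ) ≤ ∑ m ∈ Ioc z (max z n), (((I.filter (fun a => m ^ 2 ∣ a)).card : ℕ) : ℝ) := by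
        exact_mod_cast hc
      refine hc'.trans ?_
      calc _ ≤ ∑ m ∈ Ioc z (max z n), (n : ℝ) * ((m : ℝ) ^ 2)⁻¹ := by
            refine sum_le_sum fun m _ => ?_
            refine (aux_mult_card n (m ^ 2)).trans (le_of_eq ?_)
            push_cast; rw [div_eq_mul_inv]
        _ = n * ∑ m ∈ Ioc z (max z n), ((m : ℝ) ^ 2)⁻¹ := by rw [mul_sum]
        _ ≤ n * ((z : ℝ)⁻¹ - ((max z n : ℕ) : ℝ)⁻¹) := by
            apply mul_le_mul_of_nonneg_left _ (by positivity)
            exact sum_Ioc_inv_sq_le_sub (by omega) (le_max_left _ _)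
        _ ≤ n * (z : ℝ)⁻¹ := by
            apply mul_le_mul_of_nonneg_left _ (by positivity)
            have : (0 : ℝ) ≤ ((max z n : ℕ) : ℝ)⁻¹ := by positivity
            linarith
        _ = _ := by rw [div_eq_mul_inv]
    have h3 : (E3.card : ℝ) ≤ n * (1 + Real.log n) / M := by
      rw [le_div_iff₀ hM]
      refine le_trans ?_ (aux_sum_card_div n)
      refine le_trans ?_ (sum_le_sum_of_subset_of_nonneg (filter_subset _ _ : E3 ⊆ I)
        (fun a _ _ => by positivity))
      rw [← nsmul_eq_mul]
      apply card_nsmul_le_sum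
      intro a ha
      exact (mem_filter.1 ha).2.le
    have hQ : (1 : ℝ) ≤ (z : ℝ) ^ 28 := one_le_pow₀ (by exact_mod_cast hz)
    have h4 := auxBad_card n (z ^ 6) ((z : ℝ) ^ 28) M hQ hQl hn hM.le E4 (by
      intro a ha
      have ha := mem_filter.1 ha
      exact ⟨mem_Icc.1 ha.1, ha.2⟩)
    have h5 : n ≤ A.card + (E1.card + E2.card + E3.card + E4.card) := by
      have e1 : I.card ≤ A.card + (E1 ∪ E2 ∪ E3 ∪ E4).card := by
        have := le_card_sdiff (E1 ∪ E2 ∪ E3 ∪ E4) I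
        simp only [A]; omega
      have e2 := card_union_le (E1 ∪ E2 ∪ E3) E4
      have e3 := card_union_le (E1 ∪ E2) E3
      have e4 := card_union_le E1 E2
      rw [hI, Nat.card_Icc, Nat.add_sub_cancel] at e1
      omega
    have h5' : (n : ℝ) ≤ A.card + (E1.card + E2.card + E3.card + E4.card) := by exact_mod_cast h5
    have h6 : (2 * n / z : ℝ) = n / z + n / z := by ring
    rw [h6]
    linarith

lemma aux_ineq (t z : ℝ) (ht : 1 ≤ t) (hz1 : t / 2 ≤ z) (hz2 : z ≤ t) (hz : 1 ≤ z)
    (hw : Real.log t ≤ t ^ (1 / 200 : ℝ)) (hC : 600000000 < t ^ (1 / 200 : ℝ)) :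
    2 / z + (1 + t) / t ^ (5 / 4 : ℝ) + t ^ (5 / 4 : ℝ) * (28 / √t * (1 + 6 * Real.log z) *
      (56 * (2 + 28 * Real.log z) / √t) ^ 2) < t ^ (-(23 / 100) : ℝ) := by
  have ht0 : 0 < t := by linarith
  set w := t ^ (1 / 200 : ℝ) with hwdef
  set s := t ^ (-(1 / 4) : ℝ) with hs
  have hs0 : 0 < s := by positivity
  have hl0 : 0 ≤ Real.log z := Real.log_nonneg hz
  have hlw : Real.log z ≤ w := (Real.log_le_log (by linarith) hz2).trans hw
  have e1 : t⁻¹ ≤ s := by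
    rw [← Real.rpow_neg_one]
    exact Real.rpow_le_rpow_of_exponent_le ht (by norm_num)
  have h1 : 2 / z ≤ 4 * s := by
    calc 2 / z ≤ 2 / (t / 2) := div_le_div_of_nonneg_left (by norm_num) (by positivity) hz1
      _ = 4 * t⁻¹ := by field_simp; norm_num
      _ ≤ _ := by linarith
  have e2 : t / t ^ (5 / 4 : ℝ) = s := by
    rw [hs]
    nth_rewrite 1 [← Real.rpow_one t]
    rw [← Real.rpow_sub ht0]; norm_num
  have h2 : (1 + t) / t ^ (5 / 4 : ℝ) ≤ 2 * s := by
    calc (1 + t) / t ^ (5 / 4 : ℝ) ≤ (2 * t) / t ^ (5 / 4 : ℝ) := by gcongr; linarith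
      _ = 2 * (t / t ^ (5 / 4 : ℝ)) := by ring
      _ = _ := by rw [e2]
  have e3 : t ^ (5 / 4 : ℝ) * ((√t)⁻¹ * t⁻¹) = s := by
    rw [hs, Real.sqrt_eq_rpow, ← Real.rpow_neg_one t, ← Real.rpow_neg ht0.le, ← Real.rpow_add ht0,
      ← Real.rpow_add ht0]
    norm_num
  have h3 : t ^ (5 / 4 : ℝ) * (28 / √t * (1 + 6 * Real.log z) *
      (56 * (2 + 28 * Real.log z) / √t) ^ 2) =
      28 * 56 ^ 2 * s * ((1 + 6 * Real.log z) * (2 + 28 * Real.log z) ^ 2) := by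
    rw [← e3, div_pow, Real.sq_sqrt ht0.le]
    simp only [div_eq_mul_inv]
    ring
  have h4 : (1 + 6 * Real.log z) * (2 + 28 * Real.log z) ^ 2 ≤ (7 * w) * (30 * w) ^ 2 := by
    gcongr <;> linarith
  have h5 : w ^ 4 * s = t ^ (-(23 / 100) : ℝ) := by
    rw [hwdef, hs, ← Real.rpow_natCast, ← Real.rpow_mul ht0.le, ← Real.rpow_add ht0]
    norm_num
  rw [h3, ← h5]
  have h6 : 28 * 56 ^ 2 * s * ((1 + 6 * Real.log z) * (2 + 28 * Real.log z) ^ 2) ≤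
      28 * 56 ^ 2 * s * ((7 * w) * (30 * w) ^ 2) := by gcongr
  have hw1 : 1 ≤ w ^ 3 := one_le_pow₀ (by linarith)
  have hsw : s ≤ s * w ^ 3 := le_mul_of_one_le_right hs0.le hw1
  have h7 : 600000000 * (s * w ^ 3) < w * (s * w ^ 3) := by
    apply mul_lt_mul_of_pos_right hC; positivity
  nlinarith

lemma aux_upper : ∃ n0 : ℕ, ∀ n : ℕ, n0 ≤ n → ∃ A : Finset ℕ, A ⊆ Icc 1 n ∧
    (∀ (a : Fin 4 → ℕ) (x : ℕ), (∀ i, a i ∈ A) → (∏ i, a i) ≠ x ^ 3) ∧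
      (n : ℝ) - A.card < n * (Real.log n) ^ (-(23 / 100) : ℝ) := by
  have ev : ∀ᶠ t : ℝ in atTop, 4 ≤ t ∧ Real.log t ≤ t ^ (1 / 200 : ℝ) ∧
      600000000 < t ^ (1 / 200 : ℝ) ∧ 28 * Real.log t ≤ t / 4 := by
    have e1 := (isLittleO_log_rpow_atTop (show (0 : ℝ) < 1 / 200 by norm_num)).bound
      (show (0 : ℝ) < 1 by norm_num)
    have e2 := (tendsto_rpow_atTop (show (0 : ℝ) < 1 / 200 by norm_num)).eventually_gt_atTop
      600000000
    have e3 := (Real.isLittleO_log_id_atTop).bound (show (0 : ℝ) < 1 / 112 by norm_num)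
    filter_upwards [e1, e2, e3, eventually_ge_atTop 4] with t h1 h2 h3 h4
    have ht0 : 0 ≤ t := by linarith
    have hp : 0 ≤ t ^ (1 / 200 : ℝ) := by positivity
    rw [Real.norm_eq_abs, Real.norm_eq_abs, abs_of_nonneg hp, one_mul] at h1
    rw [Real.norm_eq_abs, Real.norm_eq_abs, id, abs_of_nonneg ht0] at h3
    refine ⟨h4, (le_abs_self _).trans h1, h2, ?_⟩
    have := (le_abs_self _).trans h3
    linarith
  have ev2 := (Real.tendsto_log_atTop.comp tendsto_natCast_atTop_atTop).eventually ev
  obtain ⟨n0, hn0⟩ := eventually_atTop.1 ev2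
  refine ⟨n0, fun n hn => ?_⟩
  obtain ⟨h4, hw, hC, h28⟩ := hn0 n hn
  simp only [Function.comp] at h4 hw hC h28
  set t := Real.log n with ht
  have hn1 : (0 : ℝ) < n := by
    rcases Nat.eq_zero_or_pos n with rfl | h
    · simp [ht] at h4; norm_num at h4
    · exact_mod_cast h
  set z := ⌊t⌋₊ with hz
  have hz2 : (z : ℝ) ≤ t := Nat.floor_le (by linarith)
  have hz3 : t < z + 1 := Nat.lt_floor_add_one t
  have hz1 : (1 : ℝ) ≤ z := by linarith
  have hlz : Real.log z ≤ Real.log t := Real.log_le_log (by linarith) hz2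
  have e28 : Real.log ((z : ℝ) ^ 28) = 28 * Real.log z := by rw [Real.log_pow]; norm_num
  have e6 : Real.log ((z ^ 6 : ℕ) : ℝ) = 6 * Real.log z := by
    push_cast; rw [Real.log_pow]; norm_num
  obtain ⟨A, hA1, hA2, hA3⟩ := aux_upper_raw n z (t ^ (5 / 4 : ℝ)) (by exact_mod_cast hz1)
    (by positivity) (by rw [e28, ← ht]; linarith) h4
  refine ⟨A, hA1, hA2, lt_of_le_of_lt hA3 ?_⟩
  rw [e28, e6, ← ht]
  have := mul_lt_mul_of_pos_left
    (aux_ineq t z (by linarith) (by linarith) hz2 hz1 hw hC) hn1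
  refine lt_of_eq_of_lt ?_ this
  ring

lemma aux_const : 1 - Real.exp 1 * Real.log 3 / (2 * √3) < 23 / 100 := by
  have h1 := Real.exp_one_gt_d9
  have h2 := Real.exp_one_lt_d9
  have h3 : 1 < Real.log 3 := by
    rw [Real.lt_log_iff_exp_lt (by norm_num)]; linarith
  have h4 : √3 < 1.7321 := by
    rw [Real.sqrt_lt' (by norm_num)]; norm_num
  have h5 : 0 < √3 := Real.sqrt_pos.2 (by norm_num)
  have : 77 / 100 < Real.exp 1 * Real.log 3 / (2 * √3) := by
    rw [lt_div_iff₀ (by positivity)]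
    nlinarith
  linarith

lemma aux_Fkd_mem (n : ℕ) : ∃ A : Finset ℕ, A ⊆ Finset.Icc 1 n ∧ A.card = Fkd 4 3 n ∧
    ∀ (a : Fin 4 → ℕ) (x : ℕ), (∀ i, a i ∈ A) → StrictMono a → 0 < x →
      (∏ i, a i) ≠ x ^ 3 := by
  have h := Nat.sSup_mem (s := {m : ℕ | ∃ A : Finset ℕ, A ⊆ Finset.Icc 1 n ∧ A.card = m ∧
    ∀ (a : Fin 4 → ℕ) (x : ℕ), (∀ i, a i ∈ A) → StrictMono a → 0 < x →
      (∏ i, a i) ≠ x ^ 3}) ⟨0, ∅, by simp, by simp, fun a x ha => absurd (ha 0) (by simp)⟩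
    ⟨n, by
      rintro m ⟨A, hA, rfl, _⟩
      simpa using card_le_card hA⟩
  exact h

lemma aux_Fkd_le (n : ℕ) (A : Finset ℕ) (hA : A ⊆ Finset.Icc 1 n)
    (h : ∀ (a : Fin 4 → ℕ) (x : ℕ), (∀ i, a i ∈ A) → StrictMono a → 0 < x →
      (∏ i, a i) ≠ x ^ 3) : A.card ≤ Fkd 4 3 n := by
  refine le_csSup ⟨n, ?_⟩ ⟨A, hA, rfl, h⟩
  rintro m ⟨A, hA, rfl, _⟩
  simpa using card_le_card hA

lemma aux_fkd_mem (n : ℕ) : ∃ A : Finset ℕ, A ⊆ Finset.Icc 1 n ∧ A.card = fkd 4 3 n ∧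
    ∀ (a : Fin 4 → ℕ) (x : ℕ), (∀ i, a i ∈ A) → 0 < x →
      (∏ i, a i) = x ^ 3 → TrivialSol 3 a := by
  have h := Nat.sSup_mem (s := {m : ℕ | ∃ A : Finset ℕ, A ⊆ Finset.Icc 1 n ∧ A.card = m ∧
    ∀ (a : Fin 4 → ℕ) (x : ℕ), (∀ i, a i ∈ A) → 0 < x →
      (∏ i, a i) = x ^ 3 → TrivialSol 3 a}) ⟨0, ∅, by simp, by simp, fun a x ha => absurd (ha 0) (by simp)⟩
    ⟨n, by
      rintro m ⟨A, hA, rfl, _⟩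
      simpa using card_le_card hA⟩
  exact h

lemma aux_fkd_le (n : ℕ) (A : Finset ℕ) (hA : A ⊆ Finset.Icc 1 n)
    (h : ∀ (a : Fin 4 → ℕ) (x : ℕ), (∀ i, a i ∈ A) → (∏ i, a i) ≠ x ^ 3) :
    A.card ≤ fkd 4 3 n := by
  refine le_csSup ⟨n, ?_⟩ ⟨A, hA, rfl, fun a x ha _ hx => absurd hx (h a x ha)⟩
  rintro m ⟨A, hA, rfl, _⟩
  simpa using card_le_card hA

lemma aux_not_trivial (a : Fin 4 → ℕ) (ha : StrictMono a) : ¬ TrivialSol 3 a := by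
  intro h
  have h0 := h (a 0)
  have hn : (List.ofFn a).Nodup := List.nodup_ofFn.2 ha.injective
  have hm : a 0 ∈ List.ofFn a := List.mem_ofFn.2 ⟨0, rfl⟩
  rw [Multiset.coe_count, List.count_eq_one_of_mem hn hm] at h0
  norm_num at h0

lemma aux_fkd_le_Fkd (n : ℕ) : fkd 4 3 n ≤ Fkd 4 3 n := by
  obtain ⟨A, hA1, hA2, hA3⟩ := aux_fkd_mem n
  rw [← hA2]
  refine aux_Fkd_le n A hA1 fun a x ha hmono hx heq => ?_
  exact aux_not_trivial a hmono (hA3 a x ha hx heq)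

theorem stmt_5 (ε : ℝ) (hε : 0 < ε) : ∃ n0 : ℕ, ∀ n : ℕ, n0 ≤ n →
    (n : ℝ) / (Real.log n) ^ ((2 : ℝ) + ε) < (n : ℝ) - (Fkd 4 3 n : ℝ) ∧
    (n : ℝ) - (Fkd 4 3 n : ℝ) ≤ (n : ℝ) - (fkd 4 3 n : ℝ) ∧
    (n : ℝ) - (fkd 4 3 n : ℝ) <
      (n : ℝ) / (Real.log n) ^ (1 - Real.exp 1 * Real.log 3 / (2 * Real.sqrt 3) - ε) := by
  obtain ⟨C, hC, n1, hn1⟩ := aux_lower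
  obtain ⟨n2, hn2⟩ := aux_upper
  have hlog := Real.tendsto_log_atTop.comp (tendsto_natCast_atTop_atTop (R := ℝ))
  have ev := (hlog.eventually (((tendsto_rpow_atTop hε).eventually_gt_atTop C).and
    (eventually_ge_atTop 1))).and ((eventually_ge_atTop n1).and (eventually_ge_atTop n2))
  obtain ⟨n0, hn0⟩ := eventually_atTop.1 ev
  refine ⟨n0, fun n hn => ?_⟩
  obtain ⟨⟨hCl, hl1⟩, hnn1, hnn2⟩ := hn0 n hn
  simp only [Function.comp] at hCl hl1
  have hl0 : 0 < Real.log n := by linarith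
  have hnpos : (0 : ℝ) < n := by
    rcases Nat.eq_zero_or_pos n with rfl | h
    · simp at hl0
    · exact_mod_cast h
  refine ⟨?_, ?_, ?_⟩
  · obtain ⟨A, hA1, hA2, hA3⟩ := aux_Fkd_mem n
    have h := hn1 n hnn1 A hA1 hA3
    rw [hA2] at h
    refine lt_of_lt_of_le ?_ h
    apply div_lt_div_of_pos_left hnpos (by positivity)
    rw [Real.rpow_add hl0, Real.rpow_two, mul_comm C]
    exact mul_lt_mul_of_pos_left hCl (by positivity)
  · have : (fkd 4 3 n : ℝ) ≤ Fkd 4 3 n := by exact_mod_cast aux_fkd_le_Fkd n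
    linarith
  · obtain ⟨A, hA1, hA2, hA3⟩ := hn2 n hnn2
    have h1 : (A.card : ℝ) ≤ fkd 4 3 n := by exact_mod_cast aux_fkd_le n A hA1 hA2
    have h2 : (n : ℝ) * (Real.log n) ^ (-(23 / 100) : ℝ) ≤
        (n : ℝ) / (Real.log n) ^ (1 - Real.exp 1 * Real.log 3 / (2 * Real.sqrt 3) - ε) := by
      rw [div_eq_mul_inv (n : ℝ), ← Real.rpow_neg hl0.le]
      apply mul_le_mul_of_nonneg_left _ hnpos.le
      apply Real.rpow_le_rpow_of_exponent_le hl1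
      have := aux_const
      linarith
    linarith
end

section
/- Let d ≥ 2 and k ≥ 2 be integers with d ∤ k. Then for every real α with 1/3 ≤ α ≤ 1/2, liminf_{n→∞} f_{k,d}(n)/n ≥ −log α + (log(1−α) − log α)·log α − ∫_{α}^{1−α} (log(1−t)/t) dt. -/
open Finset Filter

noncomputable def Rm (n : ℕ) : ℝ := ∑ p ∈ (Ioc 0 n).filter Nat.Prime, Real.log p / p

lemma log_fact_eq (n : ℕ) : Real.log (n.factorial) =
    ∑ p ∈ (Ioc 0 n).filter Nat.Prime, ((padicValNat p n.factorial : ℕ) : ℝ) * Real.log p := by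
  rw [Real.log_nat_eq_sum_factorization, Finsupp.sum]
  have hsub : (n.factorial).factorization.support ⊆ (Ioc 0 n).filter Nat.Prime := by
    intro p hp
    rw [Nat.support_factorization, Nat.mem_primeFactors] at hp
    simp only [mem_filter, mem_Ioc]
    exact ⟨⟨hp.1.pos, (hp.1.dvd_factorial).1 hp.2.1⟩, hp.1⟩
  rw [Finset.sum_subset hsub]
  · refine Finset.sum_congr rfl fun p hp => ?_
    rw [Nat.factorization_def _ (mem_filter.1 hp).2]
  · intro p _ hp
    rw [Finsupp.notMem_support_iff.1 hp]; simp

lemma Rm_upper (n : ℕ) (hn : 1 ≤ n) : Rm n ≤ Real.log n + Real.log 4 := by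
  have hn' : (0:ℝ) < n := by exact_mod_cast hn
  have h1 : Real.log n.factorial ≤ n * Real.log n := by
    rw [← Real.log_pow]
    apply Real.log_le_log (by positivity)
    exact_mod_cast Nat.factorial_le_pow n
  have h2 : n * Rm n - Chebyshev.theta n ≤ Real.log n.factorial := by
    rw [log_fact_eq, Rm, Chebyshev.theta, Nat.floor_natCast, Finset.mul_sum,
      ← Finset.sum_sub_distrib]
    refine Finset.sum_le_sum fun p hp => ?_
    have hpp := (mem_filter.1 hp).2
    have : Fact p.Prime := ⟨hpp⟩
    have h3 : n / p ≤ padicValNat p n.factorial := by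
      rw [padicValNat_factorial (b := Nat.log p n + 2) (by omega)]
      have := Finset.single_le_sum (f := fun i => n / p ^ i) (s := Finset.Ico 1 (Nat.log p n + 2))
        (fun _ _ => Nat.zero_le _) (a := 1) (by simp)
      simpa using this
    have h4 : (n:ℝ) / p - 1 ≤ padicValNat p n.factorial := by
      have := (Nat.sub_one_lt_floor ((n:ℝ)/p)).le
      rw [Nat.floor_div_eq_div] at this
      exact this.trans (by exact_mod_cast h3)
    have h5 : 0 ≤ Real.log p := Real.log_natCast_nonneg p
    calc (n:ℝ) * (Real.log p / p) - Real.log p = ((n:ℝ)/p - 1) * Real.log p := by ring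
      _ ≤ _ := by gcongr
  have h3 := Chebyshev.theta_le_log4_mul_x hn'.le
  have : n * Rm n ≤ n * (Real.log n + Real.log 4) := by linarith
  exact le_of_mul_le_mul_left this hn'

lemma Rm_lower : ∃ C : ℝ, 0 ≤ C ∧ ∀ n : ℕ, 1 ≤ n → Real.log n - C ≤ Rm n := by
  have hs : Summable (fun m : ℕ => 4 * ((m:ℝ) ^ (3/2:ℝ))⁻¹) :=
    (Real.summable_nat_rpow_inv.2 (by norm_num)).mul_left 4
  refine ⟨1 + ∑' m : ℕ, 4 * ((m:ℝ) ^ (3/2:ℝ))⁻¹, by positivity, fun n hn => ?_⟩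
  have hn' : (0:ℝ) < n := by exact_mod_cast hn
  have h1 : n * Real.log n - n ≤ Real.log n.factorial := by
    have := Stirling.le_log_factorial_stirling (n := n) (by omega)
    have h2 : 0 ≤ Real.log n := Real.log_natCast_nonneg n
    have h3 : 0 ≤ Real.log (2 * Real.pi) := Real.log_nonneg (by linarith [Real.pi_gt_three])
    linarith
  have h2 : Real.log n.factorial ≤ n * (Rm n + ∑' m : ℕ, 4 * ((m:ℝ) ^ (3/2:ℝ))⁻¹) := by
    have h3 := hs.sum_le_tsum ((Ioc 0 n).filter Nat.Prime) (fun i _ => by positivity)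
    have h4 : Real.log n.factorial ≤ n * (Rm n + ∑ m ∈ (Ioc 0 n).filter Nat.Prime, 4 * ((m:ℝ) ^ (3/2:ℝ))⁻¹) := by
      rw [log_fact_eq, Rm, ← Finset.sum_add_distrib, Finset.mul_sum]
      refine Finset.sum_le_sum fun p hp => ?_
      have hpp := (mem_filter.1 hp).2
      have : Fact p.Prime := ⟨hpp⟩
      have h5 := (sub_one_mul_padicValNat_factorial_lt_of_ne_zero p (n := n) (by omega)).le
      have hp2 : (2:ℝ) ≤ p := by exact_mod_cast hpp.two_le
      have h6 : ((p:ℝ) - 1) * padicValNat p n.factorial ≤ n := by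
        have : ((p - 1 : ℕ) : ℝ) * padicValNat p n.factorial ≤ n := by exact_mod_cast h5
        rwa [Nat.cast_sub hpp.one_le, Nat.cast_one] at this
      have h7 : (padicValNat p n.factorial : ℝ) ≤ n / (p - 1) := by
        rw [le_div_iff₀ (by linarith)]; linarith
      have h8 : 0 ≤ Real.log p := Real.log_natCast_nonneg p
      have h9 : Real.log p ≤ 2 * (p:ℝ)^(1/2:ℝ) := by
        have := Real.log_le_rpow_div (x := p) (by positivity) (ε := 1/2) (by norm_num)
        linarith
      have h10 : ((p:ℝ)^(3/2:ℝ))⁻¹ = (p:ℝ)^(1/2:ℝ) / p^2 := by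
        rw [← Real.rpow_neg (by positivity), ← Real.rpow_natCast, ← Real.rpow_sub (by linarith)]
        norm_num
      have h11 : (1:ℝ) / (p - 1) ≤ 1 / p + 2 / p^2 := by
        rw [div_add_div _ _ (by positivity) (by positivity), div_le_div_iff₀ (by linarith) (by positivity)]
        nlinarith [mul_nonneg (by linarith : (0:ℝ) ≤ p) (by linarith : (0:ℝ) ≤ p - 2)]
      calc (padicValNat p n.factorial : ℝ) * Real.log p ≤ n / (p-1) * Real.log p := by gcongr
        _ = n * (Real.log p * (1 / (p-1))) := by ring
        _ ≤ n * (Real.log p * (1 / p + 2/p^2)) := by gcongr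
        _ = n * (Real.log p / p + Real.log p * (2/p^2)) := by ring
        _ ≤ n * (Real.log p / p + (2 * (p:ℝ)^(1/2:ℝ)) * (2/p^2)) := by gcongr
        _ = _ := by rw [h10]; ring
    refine h4.trans ?_
    gcongr
  have h3 : n * (Real.log n - 1) ≤ n * (Rm n + ∑' m : ℕ, 4 * ((m:ℝ) ^ (3/2:ℝ))⁻¹) := by linarith
  have := le_of_mul_le_mul_left h3 hn'
  linarith

/-- floor version -/
lemma Rm_real : ∃ C : ℝ, 0 ≤ C ∧ ∀ x : ℝ, 1 ≤ x → |Rm ⌊x⌋₊ - Real.log x| ≤ C := by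
  obtain ⟨C, hC, h⟩ := Rm_lower
  have h4 : 0 ≤ Real.log 4 := Real.log_nonneg (by norm_num)
  have h2 : 0 ≤ Real.log 2 := Real.log_nonneg (by norm_num)
  refine ⟨C + Real.log 4 + Real.log 2, by positivity, fun x hx => ?_⟩
  have hf : 1 ≤ ⌊x⌋₊ := Nat.one_le_floor_iff x |>.2 hx
  have hf' : (1:ℝ) ≤ ⌊x⌋₊ := by exact_mod_cast hf
  have h1 := h _ hf
  have h3 := Rm_upper _ hf
  have h5 : Real.log ⌊x⌋₊ ≤ Real.log x := Real.log_le_log (by linarith) (Nat.floor_le (by linarith))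
  have h6 : Real.log x ≤ Real.log ⌊x⌋₊ + Real.log 2 := by
    rw [← Real.log_mul (by linarith) (by norm_num)]
    apply Real.log_le_log (by linarith)
    have := Nat.lt_floor_add_one x
    linarith
  rw [abs_le]; constructor <;> linarith

noncomputable def blk (n : ℕ) (a b : ℝ) : Finset ℕ :=
  (Ioc ⌊(n:ℝ)^a⌋₊ ⌊(n:ℝ)^b⌋₊).filter Nat.Prime

lemma mem_blk {n : ℕ} {a b : ℝ} {p : ℕ} :
    p ∈ blk n a b ↔ (n:ℝ)^a < p ∧ (p:ℝ) ≤ (n:ℝ)^b ∧ p.Prime := by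
  rw [blk, mem_filter, mem_Ioc, Nat.floor_lt (by positivity), Nat.le_floor_iff (by positivity)]
  tauto

lemma blk_split (n : ℕ) (hn : 1 ≤ n) (s : ℕ → ℝ) (hs : Monotone s) (f : ℕ → ℝ) (N : ℕ) :
    ∑ p ∈ blk n (s 0) (s N), f p = ∑ i ∈ range N, ∑ p ∈ blk n (s i) (s (i+1)), f p := by
  have hn' : (1:ℝ) ≤ n := by exact_mod_cast hn
  have hm : ∀ {i j}, i ≤ j → ⌊(n:ℝ)^(s i)⌋₊ ≤ ⌊(n:ℝ)^(s j)⌋₊ := fun h =>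
    Nat.floor_le_floor (Real.rpow_le_rpow_of_exponent_le hn' (hs h))
  induction N with
  | zero => simp [blk]
  | succ N ih =>
    rw [Finset.sum_range_succ, ← ih]
    simp only [blk, Finset.sum_filter]
    rw [Finset.sum_Ioc_consecutive _ (hm (Nat.zero_le _)) (hm (Nat.le_succ _))]

noncomputable def Tm (n : ℕ) (a b : ℝ) : ℝ := ∑ p ∈ blk n a b, 1 / (p:ℝ)

lemma Tm_nonneg (n : ℕ) (a b : ℝ) : 0 ≤ Tm n a b := Finset.sum_nonneg fun _ _ => by positivity

lemma blk_log (n : ℕ) (hn : 1 ≤ n) {a b : ℝ} (hab : a ≤ b) :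
    ∑ p ∈ blk n a b, Real.log p / p = Rm ⌊(n:ℝ)^b⌋₊ - Rm ⌊(n:ℝ)^a⌋₊ := by
  have hn' : (1:ℝ) ≤ n := by exact_mod_cast hn
  simp only [blk, Finset.sum_filter, Rm]
  rw [← Finset.sum_Ioc_consecutive _ (Nat.zero_le _)
    (Nat.floor_le_floor (Real.rpow_le_rpow_of_exponent_le hn' hab))]
  ring

lemma Tm_bounds : ∃ C : ℝ, 0 ≤ C ∧ ∀ n : ℕ, 2 ≤ n → ∀ a b : ℝ, 0 < a → a ≤ b →
    Tm n a b ≤ (b - a) / a + C / (a * Real.log n) ∧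
    (b - a) / b - C / (b * Real.log n) ≤ Tm n a b := by
  obtain ⟨C, hC, h⟩ := Rm_real
  refine ⟨2 * C, by positivity, fun n hn a b ha hab => ?_⟩
  have hn1 : (1:ℝ) < n := by exact_mod_cast hn
  have hl : 0 < Real.log n := Real.log_pos hn1
  have hb : 0 < b := ha.trans_le hab
  have e := blk_log n (by omega) hab
  have h1 := abs_le.1 (h _ (Real.one_le_rpow hn1.le ha.le))
  have h2 := abs_le.1 (h _ (Real.one_le_rpow hn1.le hb.le))
  rw [Real.log_rpow (by linarith)] at h1 h2
  constructor
  · have h3 : (a * Real.log n) * Tm n a b ≤ ∑ p ∈ blk n a b, Real.log p / p := by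
      rw [Tm, Finset.mul_sum]
      refine Finset.sum_le_sum fun p hp => ?_
      obtain ⟨h5, h6, h7⟩ := mem_blk.1 hp
      have : a * Real.log n ≤ Real.log p := by
        rw [← Real.log_rpow (by linarith)]
        exact Real.log_le_log (by positivity) h5.le
      rw [mul_one_div]
      gcongr
    have : (b - a) / a + 2 * C / (a * Real.log n) = ((b - a) * Real.log n + 2 * C) / (a * Real.log n) := by
      field_simp
    rw [this, le_div_iff₀ (by positivity)]
    linarith
  · have h3 : ∑ p ∈ blk n a b, Real.log p / p ≤ (b * Real.log n) * Tm n a b := by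
      rw [Tm, Finset.mul_sum]
      refine Finset.sum_le_sum fun p hp => ?_
      obtain ⟨h5, h6, h7⟩ := mem_blk.1 hp
      have : Real.log p ≤ b * Real.log n := by
        rw [← Real.log_rpow (by linarith)]
        exact Real.log_le_log (by exact_mod_cast h7.pos) h6
      rw [mul_one_div]
      gcongr
    have : (b - a) / b - 2 * C / (b * Real.log n) = ((b - a) * Real.log n - 2 * C) / (b * Real.log n) := by
      field_simp
    rw [this, div_le_iff₀ (by positivity)]
    linarith

lemma tendsto_div_log (K : ℝ) : Tendsto (fun n : ℕ => K / Real.log n) atTop (nhds 0) :=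
  Tendsto.const_div_atTop (Real.tendsto_log_atTop.comp tendsto_natCast_atTop_atTop) K

theorem Tm_tendsto {a b : ℝ} (ha : 0 < a) (hab : a ≤ b) :
    Tendsto (fun n => Tm n a b) atTop (nhds (Real.log (b / a))) := by
  obtain ⟨C, hC, h⟩ := Tm_bounds
  have hb : 0 < b := ha.trans_le hab
  set L := Real.log (b / a) with hL
  have hL0 : 0 ≤ L := Real.log_nonneg (by rw [le_div_iff₀ ha]; linarith)
  have key : ∀ N : ℕ, 1 ≤ N → L ≤ N → ∀ n : ℕ, 2 ≤ n →
      |Tm n a b - L| ≤ L^2 / N + (N * C / a) / Real.log n := by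
    intro N hN hLN n hn
    have hN' : (0:ℝ) < N := by exact_mod_cast hN
    have hn1 : (1:ℝ) < n := by exact_mod_cast hn
    have hl : 0 < Real.log n := Real.log_pos hn1
    set x := L / N with hx
    have hx0 : 0 ≤ x := by positivity
    have hx1 : x ≤ 1 := by rw [hx, div_le_one hN']; exact hLN
    let s : ℕ → ℝ := fun i => a * Real.exp (i * x)
    have hs : Monotone s := by
      intro i j hij
      have : (i:ℝ) ≤ j := by exact_mod_cast hij
      simp only [s]; gcongr
    have hs0 : s 0 = a := by simp [s]
    have hsN : s N = b := by
      simp only [s]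
      rw [hx, mul_div_cancel₀ _ hN'.ne', hL, Real.exp_log (by positivity)]
      field_simp
    have hsum := blk_split n (by omega) s hs (fun p => 1 / (p:ℝ)) N
    rw [hs0, hsN] at hsum
    have hsum : Tm n a b = ∑ i ∈ range N, Tm n (s i) (s (i+1)) := hsum
    have e1 := abs_le.1 (Real.abs_exp_sub_one_sub_id_le (x := x) (by rw [abs_of_nonneg hx0]; exact hx1))
    have e2 := abs_le.1 (Real.abs_exp_sub_one_sub_id_le (x := -x) (by rw [abs_neg, abs_of_nonneg hx0]; exact hx1))
    have hterm : ∀ i, |Tm n (s i) (s (i+1)) - x| ≤ x^2 + C / (a * Real.log n) := by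
      intro i
      have hsi : a ≤ s i := by rw [← hs0]; exact hs (Nat.zero_le _)
      have hsi0 : 0 < s i := ha.trans_le hsi
      have hsi' : a ≤ s (i+1) := by rw [← hs0]; exact hs (Nat.zero_le _)
      have hsi0' : 0 < s (i+1) := ha.trans_le hsi'
      obtain ⟨h1, h2⟩ := h n hn (s i) (s (i+1)) hsi0 (hs (Nat.le_succ i))
      have hr : s (i+1) = s i * Real.exp x := by
        simp only [s]; rw [mul_assoc, ← Real.exp_add]; push_cast; ring_nf
      have h3 : (s (i+1) - s i) / s i = Real.exp x - 1 := by
        rw [hr]; field_simp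
      have h4 : (s (i+1) - s i) / s (i+1) = 1 - Real.exp (-x) := by
        rw [hr, Real.exp_neg]; field_simp
      have h5 : C / (s i * Real.log n) ≤ C / (a * Real.log n) := by gcongr
      have h6 : C / (s (i+1) * Real.log n) ≤ C / (a * Real.log n) := by gcongr
      rw [h3] at h1
      rw [h4] at h2
      rw [abs_le]; constructor
      · nlinarith
      · nlinarith
    have : Tm n a b - L = ∑ i ∈ range N, (Tm n (s i) (s (i+1)) - x) := by
      rw [Finset.sum_sub_distrib, ← hsum, Finset.sum_const, card_range, nsmul_eq_mul, hx,
        mul_div_cancel₀ _ hN'.ne']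
    rw [this]
    refine (Finset.abs_sum_le_sum_abs _ _).trans ((Finset.sum_le_sum fun i _ => hterm i).trans ?_)
    rw [Finset.sum_const, card_range, nsmul_eq_mul]
    apply le_of_eq
    rw [hx]; field_simp
  rw [Metric.tendsto_atTop']
  intro ε hε
  obtain ⟨N, hN⟩ := exists_nat_ge (max (max L 1) (2 * L^2 / ε))
  have hN1 : L ≤ N := (le_max_left _ _).trans ((le_max_left _ _).trans hN)
  have hN2 : (1:ℝ) ≤ N := (le_max_right _ _).trans ((le_max_left _ _).trans hN)
  have hN3 : 2 * L^2 / ε ≤ N := (le_max_right _ _).trans hN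
  have hN4 : L^2 / N ≤ ε / 2 := by
    rw [div_le_iff₀ hε] at hN3
    rw [div_le_iff₀ (by linarith)]; linarith
  have ht := (tendsto_div_log (N * C / a)).eventually (gt_mem_nhds (half_pos hε))
  obtain ⟨M, hM⟩ := Filter.eventually_atTop.1 ht
  refine ⟨max M 2, fun n hn => ?_⟩
  have := key N (by exact_mod_cast hN2) hN1 n ((le_max_right _ _).trans hn.le)
  have h2 := hM n ((le_max_left _ _).trans hn.le)
  rw [Real.dist_eq]
  linarith

noncomputable def S2 (n : ℕ) (α : ℝ) : ℝ :=
  ∑ p ∈ blk n α 1, ∑ q ∈ (blk n α 1).filter (fun q => p * q ≤ n), 1 / ((p:ℝ) * q)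

lemma le_rpow_of_mul {n p q : ℕ} {a : ℝ} (hn : 1 ≤ n) (hq : (n:ℝ)^a < q) (h : p * q ≤ n) :
    (p:ℝ) ≤ (n:ℝ)^(1-a) := by
  have hn' : (0:ℝ) < n := by exact_mod_cast hn
  rw [Real.rpow_sub hn', Real.rpow_one, le_div_iff₀ (by positivity)]
  have : (p:ℝ) * q ≤ n := by exact_mod_cast h
  refine le_trans ?_ this
  gcongr

lemma S2_le (n : ℕ) (hn : 2 ≤ n) (α : ℝ) (h0 : 0 < α) (s : ℕ → ℝ) (hs : Monotone s) (N : ℕ)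
    (hs0 : s 0 = α) (hsN : s N = 1 - α) :
    S2 n α ≤ ∑ i ∈ range N, Tm n (s i) (s (i+1)) * Tm n α (1 - s i) := by
  have hn1 : (1:ℝ) ≤ n := by exact_mod_cast (by omega : 1 ≤ n)
  have e : S2 n α = ∑ p ∈ blk n α (1-α),
      ∑ q ∈ (blk n α 1).filter (fun q => p * q ≤ n), 1 / ((p:ℝ) * q) := by
    symm
    apply Finset.sum_subset
    · intro p hp
      rw [mem_blk] at hp ⊢
      exact ⟨hp.1, hp.2.1.trans (Real.rpow_le_rpow_of_exponent_le hn1 (by linarith)), hp.2.2⟩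
    · intro p hp hp'
      apply Finset.sum_eq_zero
      intro q hq
      exfalso
      apply hp'
      rw [mem_filter, mem_blk] at hq
      rw [mem_blk] at hp ⊢
      exact ⟨hp.1, le_rpow_of_mul (by omega) hq.1.1 hq.2, hp.2.2⟩
  rw [e]
  have := blk_split n (by omega) s hs
    (fun p => ∑ q ∈ (blk n α 1).filter (fun q => p * q ≤ n), 1 / ((p:ℝ) * q)) N
  rw [hs0, hsN] at this
  rw [this]
  refine Finset.sum_le_sum fun i _ => ?_
  rw [Tm, Finset.sum_mul]
  refine Finset.sum_le_sum fun p hp => ?_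
  rw [mem_blk] at hp
  rw [Tm, Finset.mul_sum]
  have : ∀ q : ℕ, 1 / (p:ℝ) * (1 / (q:ℝ)) = 1 / ((p:ℝ) * q) := fun q => by
    rw [div_mul_div_comm, one_mul]
  simp only [this]
  apply Finset.sum_le_sum_of_subset_of_nonneg
  · intro q hq
    rw [mem_filter, mem_blk] at hq
    rw [mem_blk]
    exact ⟨hq.1.1, le_rpow_of_mul (by omega) hp.1 (by rw [mul_comm]; exact hq.2), hq.1.2.2⟩
  · intros; positivity

lemma phi_int {α a b : ℝ} (h0 : 0 < α) (ha : α ≤ a) (hab : a ≤ b) (hb : b ≤ 1 - α) :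
    IntervalIntegrable (fun t => (Real.log (1 - t) - Real.log α) / t) MeasureTheory.volume a b := by
  apply ContinuousOn.intervalIntegrable
  rw [Set.uIcc_of_le hab]
  apply ContinuousOn.div _ continuousOn_id
  · intro t ht; simp only [id]; linarith [ht.1]
  · apply ContinuousOn.sub _ continuousOn_const
    apply ContinuousOn.log (by fun_prop)
    intro t ht; linarith [ht.2]

lemma piece {α a b : ℝ} (h0 : 0 < α) (ha : α ≤ a) (hab : a ≤ b) (hb : b ≤ 1 - α) :
    Real.log (b / a) * Real.log ((1 - a) / α) ≤
      (∫ t in a..b, (Real.log (1 - t) - Real.log α) / t) + (b - a)^2 / α^2 := by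
  have ha0 : 0 < a := h0.trans_le ha
  have e1 : Real.log (b / a) * Real.log ((1 - a) / α) =
      ∫ t in a..b, Real.log ((1 - a) / α) * (1 / t) := by
    rw [intervalIntegral.integral_const_mul, integral_one_div_of_pos ha0 (by linarith), mul_comm]
  have e2 : (∫ t in a..b, (Real.log (1 - t) - Real.log α) / t) + (b - a)^2 / α^2 =
      ∫ t in a..b, ((Real.log (1 - t) - Real.log α) / t + (b - a) / α^2) := by
    rw [intervalIntegral.integral_add (phi_int h0 ha hab hb) (by simp),
      intervalIntegral.integral_const, smul_eq_mul]
    ring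
  rw [e1, e2]
  apply intervalIntegral.integral_mono_on hab
  · apply ContinuousOn.intervalIntegrable
    rw [Set.uIcc_of_le hab]
    apply ContinuousOn.mul continuousOn_const
    apply ContinuousOn.div continuousOn_const continuousOn_id
    intro t ht; simp only [id]; linarith [ht.1]
  · exact (phi_int h0 ha hab hb).add (by simp)
  · intro t ht
    have ht0 : 0 < t := by linarith [ht.1]
    have hat : α ≤ t := by linarith [ht.1]
    have h1t : α ≤ 1 - t := by linarith [ht.2]
    have h1t0 : 0 < 1 - t := by linarith
    rw [Real.log_div (by linarith [ht.1]) h0.ne']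
    have h1 : Real.log (1 - a) - Real.log (1 - t) ≤ (b - a) / α := by
      rw [← Real.log_div (by linarith [ht.1]) h1t0.ne']
      refine (Real.log_le_sub_one_of_pos (div_pos (by linarith [ht.1]) h1t0)).trans ?_
      have : (1 - a) / (1 - t) - 1 = (t - a) / (1 - t) := by field_simp; ring
      rw [this]
      exact div_le_div₀ (by linarith) (by linarith [ht.2]) h0 h1t
    have h2 : (b - a) / α / t ≤ (b - a) / α ^ 2 := by
      rw [div_div, sq]
      apply div_le_div_of_nonneg_left (by linarith) (by positivity)
      gcongr
    have h3 : (Real.log (1 - a) - Real.log (1 - t)) / t ≤ (b - a) / α / t := by gcongr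
    have h4 : (Real.log (1 - a) - Real.log α) * (1 / t) =
      (Real.log (1 - t) - Real.log α) / t + (Real.log (1 - a) - Real.log (1 - t)) / t := by ring
    linarith

lemma riemann {α ε : ℝ} (h0 : 0 < α) (h2 : α ≤ 1/2) (hε : 0 < ε) :
    ∃ (s : ℕ → ℝ) (N : ℕ), Monotone s ∧ s 0 = α ∧ s N = 1 - α ∧
      ∑ i ∈ range N, Real.log (s (i+1) / s i) * Real.log ((1 - s i) / α) ≤
        (∫ t in α..(1-α), (Real.log (1 - t) - Real.log α) / t) + ε := by
  obtain ⟨N, hN⟩ := exists_nat_ge (max 1 ((1 - 2*α)^2 / α^2 / ε))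
  have hN1 : (1:ℝ) ≤ N := (le_max_left _ _).trans hN
  have hN2 := (le_max_right _ _).trans hN
  have hN0 : (0:ℝ) < N := by linarith
  set h := (1 - 2*α) / N with hh
  have hh0 : 0 ≤ h := div_nonneg (by linarith) hN0.le
  let s : ℕ → ℝ := fun i => α + i * h
  have hs : Monotone s := by
    intro i j hij
    have : (i:ℝ) ≤ j := by exact_mod_cast hij
    simp only [s]; gcongr
  have hs0 : s 0 = α := by simp [s]
  have hsN : s N = 1 - α := by simp only [s]; rw [hh, mul_div_cancel₀ _ hN0.ne']; ring
  refine ⟨s, N, hs, hs0, hsN, ?_⟩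
  have hge : ∀ i, α ≤ s i := fun i => by rw [← hs0]; exact hs (Nat.zero_le _)
  have hle : ∀ i, i ≤ N → s i ≤ 1 - α := fun i hi => by rw [← hsN]; exact hs hi
  have hd : ∀ i, s (i+1) - s i = h := fun i => by simp only [s]; push_cast; ring
  have hI := intervalIntegral.sum_integral_adjacent_intervals (a := s) (n := N)
    (f := fun t => (Real.log (1 - t) - Real.log α) / t) (μ := MeasureTheory.volume)
    (fun k hk => phi_int h0 (hge k) (hs (Nat.le_succ k)) (hle _ hk))
  rw [hs0, hsN] at hI
  rw [← hI]
  calc _ ≤ ∑ i ∈ range N, ((∫ t in (s i)..(s (i+1)), (Real.log (1 - t) - Real.log α) / t)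
          + (s (i+1) - s i)^2 / α^2) :=
        Finset.sum_le_sum fun i hi => piece h0 (hge i) (hs (Nat.le_succ i)) (hle _ (mem_range.1 hi))
    _ = (∑ i ∈ range N, ∫ t in (s i)..(s (i+1)), (Real.log (1 - t) - Real.log α) / t)
          + N * (h^2 / α^2) := by
        simp only [hd]
        rw [Finset.sum_add_distrib, Finset.sum_const, card_range, nsmul_eq_mul]
    _ ≤ _ := by
        gcongr
        have : N * (h^2 / α^2) = (1 - 2*α)^2 / α^2 / N := by rw [hh]; field_simp
        rw [this, div_le_iff₀ hN0]
        rw [div_le_iff₀ hε] at hN2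
        linarith

lemma S2_eventually {α ε : ℝ} (h0 : 0 < α) (h2 : α ≤ 1/2) (hε : 0 < ε) :
    ∀ᶠ n : ℕ in atTop, S2 n α ≤
      (∫ t in α..(1-α), (Real.log (1 - t) - Real.log α) / t) + ε := by
  obtain ⟨s, N, hs, hs0, hsN, hsum⟩ := riemann h0 h2 (half_pos hε)
  have hge : ∀ i, α ≤ s i := fun i => by rw [← hs0]; exact hs (Nat.zero_le _)
  have hle : ∀ i, i ≤ N → s i ≤ 1 - α := fun i hi => by rw [← hsN]; exact hs hi
  have ht : Tendsto (fun n => ∑ i ∈ range N, Tm n (s i) (s (i+1)) * Tm n α (1 - s i)) atTop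
      (nhds (∑ i ∈ range N, Real.log (s (i+1) / s i) * Real.log ((1 - s i) / α))) := by
    apply tendsto_finsetSum
    intro i hi
    apply Tendsto.mul
    · exact Tm_tendsto (h0.trans_le (hge i)) (hs (Nat.le_succ i))
    · exact Tm_tendsto h0 (by linarith [hle i (mem_range.1 hi).le])
  have := ht.eventually (gt_mem_nhds (lt_add_of_pos_right _ (half_pos hε)))
  filter_upwards [this, eventually_ge_atTop 2] with n hn hn2
  have := S2_le n hn2 α h0 s hs N hs0 hsN
  linarith

lemma int_eq {α : ℝ} (h0 : 0 < α) (h2 : α ≤ 1/2) :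
    (∫ t in α..(1-α), (Real.log (1 - t) - Real.log α) / t) =
      (∫ t in α..(1-α), Real.log (1 - t) / t) - (Real.log (1 - α) - Real.log α) * Real.log α := by
  have hI : IntervalIntegrable (fun t => Real.log α * (1 / t)) MeasureTheory.volume α (1-α) := by
    apply ContinuousOn.intervalIntegrable
    rw [Set.uIcc_of_le (by linarith)]
    apply ContinuousOn.mul continuousOn_const
    apply ContinuousOn.div continuousOn_const continuousOn_id
    intro t ht; simp only [id]; linarith [ht.1]
  have e : (∫ t in α..(1-α), Real.log (1 - t) / t) =
      ∫ t in α..(1-α), ((Real.log (1 - t) - Real.log α) / t + Real.log α * (1 / t)) := by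
    congr 1; ext t; ring
  rw [e, intervalIntegral.integral_add (phi_int h0 le_rfl (by linarith) le_rfl) hI,
    intervalIntegral.integral_const_mul, integral_one_div_of_pos h0 (by linarith),
    Real.log_div (by linarith) h0.ne']
  ring

lemma pointwise (P : Finset ℕ) (hP : ∀ p ∈ P, p.Prime) (m : ℕ) (hm : m ≠ 0) :
    (P.filter (fun p => p ∣ m)).card ≤
      (if ∑ p ∈ P, m.factorization p = 1 then 1 else 0) +
      ((P ×ˢ P).filter (fun x => x.1 * x.2 ∣ m)).card := by
  set S := P.filter (fun p => p ∣ m) with hS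
  have hoff : S.card * S.card - S.card ≤ ((P ×ˢ P).filter (fun x => x.1 * x.2 ∣ m)).card := by
    rw [← Finset.offDiag_card]
    apply Finset.card_le_card
    rintro ⟨p, q⟩ hx
    rw [Finset.mem_offDiag] at hx
    obtain ⟨hp, hq, hne⟩ := hx
    simp only [hS, mem_filter] at hp hq
    simp only [mem_filter, mem_product]
    exact ⟨⟨hp.1, hq.1⟩, Nat.Coprime.mul_dvd_of_dvd_of_dvd
      ((Nat.coprime_primes (hP p hp.1) (hP q hq.1)).2 hne) hp.2 hq.2⟩
  rcases Nat.lt_or_ge S.card 2 with h | h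
  · rcases Nat.eq_zero_or_pos S.card with h0 | h1
    · rw [h0]; exact Nat.zero_le _
    · have h1 : S.card = 1 := by omega
      obtain ⟨p, hp⟩ := Finset.card_eq_one.1 h1
      have hpS : p ∈ S := by rw [hp]; simp
      have hpS' := mem_filter.1 hpS
      rw [h1]
      by_cases hsq : p * p ∣ m
      · have : 0 < ((P ×ˢ P).filter (fun x => x.1 * x.2 ∣ m)).card := by
          apply Finset.card_pos.2
          exact ⟨(p, p), by simp [hpS'.1, hsq]⟩
        omega
      · have : ∑ p ∈ P, m.factorization p = 1 := by
          rw [Finset.sum_eq_single_of_mem p hpS'.1]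
          · have hpp := hP p hpS'.1
            have h3 : 1 ≤ m.factorization p := hpp.factorization_pos_of_dvd hm hpS'.2
            have h4 : ¬ 2 ≤ m.factorization p := by
              intro h
              apply hsq
              rw [← sq]
              exact (hpp.pow_dvd_iff_le_factorization hm).2 h
            omega
          · intro q hq hne
            apply Nat.factorization_eq_zero_of_not_dvd
            intro hd
            have : q ∈ S := mem_filter.2 ⟨hq, hd⟩
            rw [hp] at this
            exact hne (by simpa using this)
        rw [if_pos this]; omega
  · have : S.card * 2 ≤ S.card * S.card := Nat.mul_le_mul_left _ h
    omega

lemma count (P : Finset ℕ) (hP : ∀ p ∈ P, p.Prime) (n : ℕ) :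
    ∑ p ∈ P, n / p ≤ ((Ioc 0 n).filter (fun m => ∑ p ∈ P, m.factorization p = 1)).card +
      ∑ p ∈ P, ∑ q ∈ P, n / (p * q) := by
  have e1 : ∑ p ∈ P, n / p = ∑ m ∈ Ioc 0 n, (P.filter (fun p => p ∣ m)).card := by
    simp only [← Nat.Ioc_filter_dvd_card_eq_div, Finset.card_filter]
    rw [Finset.sum_comm]
  have e2 : ∑ p ∈ P, ∑ q ∈ P, n / (p * q) =
      ∑ m ∈ Ioc 0 n, ((P ×ˢ P).filter (fun x => x.1 * x.2 ∣ m)).card := by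
    rw [← Finset.sum_product' (f := fun p q => n / (p * q))]
    simp only [← Nat.Ioc_filter_dvd_card_eq_div, Finset.card_filter]
    rw [Finset.sum_comm]
  rw [e1, e2, Finset.card_filter, ← Finset.sum_add_distrib]
  refine Finset.sum_le_sum fun m hm => pointwise P hP m ?_
  have := (mem_Ioc.1 hm).1
  omega

lemma fkd_set_le (k d n m : ℕ) (hm : m ∈ {m : ℕ | ∃ A : Finset ℕ, A ⊆ Finset.Icc 1 n ∧ A.card = m ∧
    ∀ (a : Fin k → ℕ) (x : ℕ), (∀ i, a i ∈ A) → 0 < x →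
      (∏ i, a i) = x ^ d → TrivialSol d a}) : m ≤ n := by
  obtain ⟨A, hA, rfl, _⟩ := hm
  simpa using Finset.card_le_card hA

lemma fkd_le (k d n : ℕ) : fkd k d n ≤ n :=
  csSup_le' fun m hm => fkd_set_le k d n m hm

lemma card_le_fkd (k d n : ℕ) (hdk : ¬ d ∣ k) (P : Finset ℕ) :
    ((Ioc 0 n).filter (fun m => ∑ p ∈ P, m.factorization p = 1)).card ≤ fkd k d n := by
  apply le_csSup ⟨n, fun m hm => fkd_set_le k d n m hm⟩
  refine ⟨_, ?_, rfl, ?_⟩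
  · intro m hm
    have := mem_Ioc.1 (mem_filter.1 hm).1
    rw [Finset.mem_Icc]; omega
  · intro a x ha hx hprod
    exfalso
    apply hdk
    refine ⟨∑ p ∈ P, x.factorization p, ?_⟩
    have h1 : ∑ p ∈ P, (∏ i, a i).factorization p = k := by
      have h2 : ∀ p, (∏ i, a i).factorization p = ∑ i, (a i).factorization p := fun p =>
        Nat.factorization_prod_apply fun i _ => by
          have := mem_Ioc.1 (mem_filter.1 (ha i)).1
          omega
      simp only [h2]
      rw [Finset.sum_comm, Finset.sum_congr rfl fun i _ => (mem_filter.1 (ha i)).2]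
      simp
    rw [← h1, hprod, Nat.factorization_pow, Finset.mul_sum]
    simp

lemma card_blk (n : ℕ) (hn : 2 ≤ n) {α : ℝ} (h0 : 0 < α) :
    ((blk n α 1).card : ℝ) ≤ n * ((Real.log 4 / α) / Real.log n) := by
  have hn1 : (1:ℝ) < n := by exact_mod_cast hn
  have hl : 0 < Real.log n := Real.log_pos hn1
  have h1 : (blk n α 1).card * (α * Real.log n) ≤ Chebyshev.theta n := by
    rw [← nsmul_eq_mul]
    refine (Finset.card_nsmul_le_sum (blk n α 1) (fun p => Real.log p) _ ?_).trans ?_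
    · intro p hp
      rw [← Real.log_rpow (by linarith)]
      exact Real.log_le_log (by positivity) (mem_blk.1 hp).1.le
    · rw [Chebyshev.theta, Nat.floor_natCast]
      apply Finset.sum_le_sum_of_subset_of_nonneg
      · intro p hp
        rw [mem_blk, Real.rpow_one] at hp
        simp only [mem_filter, mem_Ioc]
        exact ⟨⟨hp.2.2.pos, by exact_mod_cast hp.2.1⟩, hp.2.2⟩
      · intro p _ _; exact Real.log_natCast_nonneg p
  have h2 := h1.trans (Chebyshev.theta_le_log4_mul_x (by linarith))
  rw [← le_div_iff₀ (by positivity)] at h2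
  refine h2.trans (le_of_eq ?_)
  field_simp

lemma main_ineq (k d n : ℕ) (hdk : ¬ d ∣ k) (hn : 2 ≤ n) {α : ℝ} (h0 : 0 < α) :
    Tm n α 1 - (Real.log 4 / α) / Real.log n - S2 n α ≤ (fkd k d n : ℝ) / n := by
  have hn0 : (0:ℝ) < n := by exact_mod_cast (by omega : 0 < n)
  rw [le_div_iff₀ hn0]
  have h1 := count (blk n α 1) (fun p hp => (mem_blk.1 hp).2.2) n
  have h2 := card_le_fkd k d n hdk (blk n α 1)
  have h3 : ((∑ p ∈ blk n α 1, n / p : ℕ) : ℝ) ≤ fkd k d n +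
      ((∑ p ∈ blk n α 1, ∑ q ∈ blk n α 1, n / (p * q) : ℕ) : ℝ) := by
    exact_mod_cast h1.trans (Nat.add_le_add_right h2 _)
  have h4 : n * Tm n α 1 - (blk n α 1).card ≤ ((∑ p ∈ blk n α 1, n / p : ℕ) : ℝ) := by
    rw [Tm, Finset.mul_sum, Finset.card_eq_sum_ones]
    push_cast
    rw [← Finset.sum_sub_distrib]
    refine Finset.sum_le_sum fun p _ => ?_
    have := (Nat.sub_one_lt_floor ((n:ℝ)/p)).le
    rw [Nat.floor_div_eq_div] at this
    rw [mul_one_div]; exact this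
  have h5 : ((∑ p ∈ blk n α 1, ∑ q ∈ blk n α 1, n / (p * q) : ℕ) : ℝ) ≤ n * S2 n α := by
    rw [S2, Finset.mul_sum]
    push_cast
    refine Finset.sum_le_sum fun p _ => ?_
    rw [Finset.mul_sum, Finset.sum_filter]
    refine Finset.sum_le_sum fun q _ => ?_
    split_ifs with h
    · rw [mul_one_div]
      have := Nat.cast_div_le (α := ℝ) (m := n) (n := p * q)
      push_cast at this
      exact this
    · rw [Nat.div_eq_of_lt (by omega)]; simp
  have h6 := card_blk n hn h0
  nlinarith

theorem stmt_6 (k d : ℕ) (hd : 2 ≤ d) (hk : 2 ≤ k) (hdk : ¬ d ∣ k)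
    (α : ℝ) (hα1 : 1/3 ≤ α) (hα2 : α ≤ 1/2) :
    -Real.log α + (Real.log (1 - α) - Real.log α) * Real.log α
        - ∫ t in α..(1 - α), Real.log (1 - t) / t
      ≤ Filter.liminf (fun n : ℕ => (fkd k d n : ℝ) / (n : ℝ)) Filter.atTop := by
  have h0 : 0 < α := by linarith
  apply le_of_forall_pos_le_add
  intro ε hε
  rw [← sub_le_iff_le_add]
  apply Filter.le_liminf_of_le
  · apply Filter.IsBoundedUnder.isCoboundedUnder_ge
    refine Filter.isBoundedUnder_of ⟨1, fun n => ?_⟩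
    apply div_le_one_of_le₀ _ (Nat.cast_nonneg n)
    exact_mod_cast fkd_le k d n
  · have hε3 : 0 < ε / 3 := by linarith
    have e1 := S2_eventually h0 hα2 hε3
    have e2 := (tendsto_div_log (Real.log 4 / α)).eventually (gt_mem_nhds hε3)
    have e3 := (Tm_tendsto h0 (by linarith : α ≤ 1)).eventually
      (lt_mem_nhds (sub_lt_self _ hε3))
    filter_upwards [e1, e2, e3, eventually_ge_atTop 2] with n h1 h2 h3 hn
    have := main_ineq k d n hdk hn h0
    rw [int_eq h0 hα2] at h1
    rw [one_div, Real.log_inv] at h3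
    linarith
end
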